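/- arXiv:math/0410304 — 3 statements merged into one kernel-verified Lean document; each statement's English description precedes it below -/
import Mathlib

section
/- Let R be a commutative Noetherian ring, J ⊆ R an ideal, and S₁ = R[X₁,…,X_r] the polynomial ring graded by total degree. Let T be a graded S₁-module and U, V, W, Z finitely generated graded S₁-submodules of T with Z ⊆ U and W ⊆ V. For m ≥ 0 set L_m := (U + J^m V)/(Z + J^m W). If the n-th homogeneous component (L_m)_n has finite length over R for all sufficiently large m and n, then there exist a polynomial p ∈ ℚ[x,y] and integers m₀, n₀ such that length_R((L_m)_n) = p(m,n) for all m ≥ m₀ and n ≥ n₀. -/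
/-- The length of a module: the Krull dimension of its lattice of submodules. -/
noncomputable def modLength (R : Type) [CommRing R]
    (M : Type) [AddCommGroup M] [Module R M] : WithBot ℕ∞ :=
  Order.krullDim (Submodule R M)

/-- The quotient of a submodule `X` by (its intersection with) a submodule `Y`. -/
abbrev subQuot (S : Type) [CommRing S] (F : Type) [AddCommGroup F] [Module S F]
    (X Y : Submodule S F) : Type :=
  ↥X ⧸ Submodule.comap X.subtype Y

open Filter

section EventuallyPolynomial

/-- `f` agrees with a polynomial in both variables on all sufficiently large pairs. -/
def EventuallyPolynomial (f : ℕ × ℕ → ℚ) : Prop :=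
  ∃ p : MvPolynomial (Fin 2) ℚ, ∀ᶠ d in atTop,
    f d = MvPolynomial.eval ![(d.1 : ℚ), (d.2 : ℚ)] p

theorem tendsto_add_right_atTop_prod (e : ℕ × ℕ) :
    Tendsto (fun d : ℕ × ℕ => d + e) atTop atTop :=
  tendsto_atTop_mono (fun _ => le_self_add) tendsto_id

theorem tendsto_swap_atTop_prod : Tendsto (Prod.swap : ℕ × ℕ → ℕ × ℕ) atTop atTop :=
  tendsto_atTop_atTop.2 fun b => ⟨b.swap, fun _ h => ⟨h.2, h.1⟩⟩

theorem eval_bind₁_pair {τ : Type*} (v : τ → ℚ) (φ ψ : MvPolynomial τ ℚ)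
    (p : MvPolynomial (Fin 2) ℚ) :
    MvPolynomial.eval v (MvPolynomial.bind₁ ![φ, ψ] p) =
      MvPolynomial.eval ![MvPolynomial.eval v φ, MvPolynomial.eval v ψ] p := by
  refine (MvPolynomial.eval₂Hom_bind₁ _ _ _ _).trans ?_
  refine congrArg (fun w => MvPolynomial.eval w p) (funext fun i => ?_)
  fin_cases i <;> rfl

namespace EventuallyPolynomial

variable {f g : ℕ × ℕ → ℚ}

theorem congr (hf : EventuallyPolynomial f) (h : ∀ᶠ d in atTop, g d = f d) :
    EventuallyPolynomial g := by
  obtain ⟨p, hp⟩ := hf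
  exact ⟨p, by filter_upwards [h, hp] with d h₁ h₂ using h₁.trans h₂⟩

theorem zero : EventuallyPolynomial fun _ => 0 := ⟨0, by simp⟩

theorem add (hf : EventuallyPolynomial f) (hg : EventuallyPolynomial g) :
    EventuallyPolynomial fun d => f d + g d := by
  obtain ⟨p, hp⟩ := hf
  obtain ⟨q, hq⟩ := hg
  exact ⟨p + q, by filter_upwards [hp, hq] with d h₁ h₂; simp [h₁, h₂]⟩

theorem sub (hf : EventuallyPolynomial f) (hg : EventuallyPolynomial g) :
    EventuallyPolynomial fun d => f d - g d := by
  obtain ⟨p, hp⟩ := hf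
  obtain ⟨q, hq⟩ := hg
  exact ⟨p - q, by filter_upwards [hp, hq] with d h₁ h₂; simp [h₁, h₂]⟩

theorem comp_add (hf : EventuallyPolynomial f) (e : ℕ × ℕ) :
    EventuallyPolynomial fun d => f (d + e) := by
  obtain ⟨p, hp⟩ := hf
  refine ⟨MvPolynomial.bind₁ ![MvPolynomial.X 0 + MvPolynomial.C (e.1 : ℚ),
    MvPolynomial.X 1 + MvPolynomial.C (e.2 : ℚ)] p, ?_⟩
  filter_upwards [(tendsto_add_right_atTop_prod e).eventually hp] with d h
  rw [h, eval_bind₁_pair]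
  simp

theorem comp_swap (hf : EventuallyPolynomial f) :
    EventuallyPolynomial fun d => f d.swap := by
  obtain ⟨p, hp⟩ := hf
  refine ⟨MvPolynomial.rename (Equiv.swap 0 1) p, ?_⟩
  filter_upwards [tendsto_swap_atTop_prod.eventually hp] with d h
  rw [h, MvPolynomial.eval_rename]
  congr 2
  funext i
  fin_cases i <;> simp

/-- Every polynomial in two variables is the first difference of a polynomial. -/
theorem exists_eval_add_one_sub_eval (p : MvPolynomial (Fin 2) ℚ) :
    ∃ q : MvPolynomial (Fin 2) ℚ, ∀ s t : ℚ,
      MvPolynomial.eval ![s + 1, t] q - MvPolynomial.eval ![s, t] q =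
        MvPolynomial.eval ![s, t] p := by
  induction p using MvPolynomial.induction_on' with
  | monomial u a =>
    refine ⟨Polynomial.aeval (MvPolynomial.X 0) (Polynomial.bernoulli (u 0 + 1)) *
      MvPolynomial.C (a / (u 0 + 1)) * MvPolynomial.X 1 ^ u 1, fun s t => ?_⟩
    have key : ∀ s' : ℚ, MvPolynomial.eval ![s', t]
        (Polynomial.aeval (MvPolynomial.X 0 : MvPolynomial (Fin 2) ℚ)
          (Polynomial.bernoulli (u 0 + 1))) = (Polynomial.bernoulli (u 0 + 1)).eval s' := by
      intro s'
      rw [Polynomial.aeval_def, Polynomial.hom_eval₂, Polynomial.eval, MvPolynomial.eval_X]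
      congr 1
      ext; simp
    have h0 : ((u 0 : ℚ) + 1) ≠ 0 := by positivity
    simp only [map_mul, key, MvPolynomial.eval_C, map_pow, MvPolynomial.eval_X,
      add_comm s 1, Polynomial.bernoulli_eval_one_add, MvPolynomial.eval_monomial]
    rw [Finsupp.prod_fintype _ _ (by simp)]
    simp
    field_simp
    ring
  | add p q hp hq =>
    obtain ⟨p', hp⟩ := hp
    obtain ⟨q', hq⟩ := hq
    exact ⟨p' + q', fun s t => by simp [← hp, ← hq]; ring⟩

/-- A function whose first difference is eventually polynomial is eventually polynomial as soon
as its restriction to every far enough vertical line is. -/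
theorem of_fst_difference
    (h : EventuallyPolynomial fun d => f (d + (1, 0)) - f d)
    (hl : ∀ᶠ m in atTop, EventuallyPolynomial fun d => f (m, d.2)) :
    EventuallyPolynomial f := by
  obtain ⟨p, hp⟩ := h
  obtain ⟨q, hq⟩ := exists_eval_add_one_sub_eval p
  obtain ⟨⟨a, b⟩, hab⟩ := eventually_atTop.1 hp
  obtain ⟨m, hm, hl⟩ := ((eventually_ge_atTop a).and hl).exists
  have main : ∀ k n, b ≤ n → f (m + k, n) = f (m, n) +
      (MvPolynomial.eval ![((m + k : ℕ) : ℚ), (n : ℚ)] q -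
        MvPolynomial.eval ![(m : ℚ), (n : ℚ)] q) := by
    intro k n hn
    induction k with
    | zero => simp
    | succ k ih =>
      have h₁ := hab (m + k, n) ⟨by simp; omega, hn⟩
      have h₂ := hq ((m + k : ℕ) : ℚ) n
      simp only [Prod.mk_add_mk, add_zero] at h₁
      rw [← add_assoc, ← sub_add_cancel (f (m + k + 1, n)) (f (m + k, n)), h₁, ih, ← h₂]
      push_cast
      ring
  have hQ : EventuallyPolynomial fun d => MvPolynomial.eval ![(d.1 : ℚ), (d.2 : ℚ)] q :=
    ⟨q, by simp⟩
  have hQ' : EventuallyPolynomial fun d => MvPolynomial.eval ![(m : ℚ), (d.2 : ℚ)] q := by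
    refine ⟨MvPolynomial.bind₁ ![MvPolynomial.C (m : ℚ), MvPolynomial.X 1] q,
      Eventually.of_forall fun d => ?_⟩
    simp [eval_bind₁_pair]
  refine (hl.add (hQ.sub hQ')).congr ?_
  filter_upwards [eventually_ge_atTop ((m, b) : ℕ × ℕ)] with d hd
  have := main (d.1 - m) d.2 hd.2
  rw [Nat.add_sub_cancel' hd.1] at this
  exact this

/-- A function both of whose partial differences are eventually polynomial is itself
eventually polynomial. -/
theorem of_differences
    (h₁ : EventuallyPolynomial fun d => f (d + (1, 0)) - f d)
    (h₂ : EventuallyPolynomial fun d => f (d + (0, 1)) - f d) :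
    EventuallyPolynomial f := by
  refine of_fst_difference h₁ ?_
  obtain ⟨p, hp⟩ := h₂
  obtain ⟨⟨a, b⟩, hab⟩ := eventually_atTop.1 hp
  filter_upwards [eventually_ge_atTop a] with m hm
  have key : EventuallyPolynomial fun d => f (m, d.1) := by
    refine of_fst_difference ?_ (Eventually.of_forall fun k => ⟨MvPolynomial.C (f (m, k)), by simp⟩)
    refine ⟨MvPolynomial.bind₁ ![MvPolynomial.C (m : ℚ), MvPolynomial.X 0] p, ?_⟩
    filter_upwards [eventually_ge_atTop (b, 0)] with d hd
    have := hab (m, d.1) ⟨hm, hd.1⟩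
    simp only [Prod.mk_add_mk, add_zero, Prod.fst_add] at this ⊢
    rw [this, eval_bind₁_pair]
    simp
  exact key.comp_swap

end EventuallyPolynomial

end EventuallyPolynomial

section RelativeLength

variable {R : Type} [CommRing R] {T : Type} [AddCommGroup T] [Module R T]

/-- The length of the subquotient `X / (X ∩ Y)`. -/
noncomputable def relLength (X Y : Submodule R T) : ℕ∞ :=
  Module.length R (subQuot R T X Y)

theorem relLength_eq_length_map (X Y : Submodule R T) :
    relLength X Y = Module.length R (X.map Y.mkQ) := by
  have hk : LinearMap.ker (Y.mkQ ∘ₗ X.subtype) = Y.comap X.subtype := by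
    rw [LinearMap.ker_comp, Submodule.ker_mkQ]
  have hr : LinearMap.range (Y.mkQ ∘ₗ X.subtype) = X.map Y.mkQ := by
    rw [LinearMap.range_comp, Submodule.range_subtype]
  rw [relLength, ← hr, ← (LinearMap.quotKerEquivRange _).length_eq]
  exact (Submodule.quotEquivOfEq _ _ hk.symm).length_eq

theorem relLength_sup_map (X Y : Submodule R T) (φ : T →ₗ[R] T) :
    relLength (Y ⊔ X.map φ) Y = relLength X (X ⊓ Y.comap φ) := by
  have hk : LinearMap.ker (Y.mkQ ∘ₗ φ ∘ₗ X.subtype) =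
      (X ⊓ Y.comap φ).comap X.subtype := by
    ext z
    simp
  have hr : LinearMap.range (Y.mkQ ∘ₗ φ ∘ₗ X.subtype) = (Y ⊔ X.map φ).map Y.mkQ := by
    rw [LinearMap.range_comp, LinearMap.range_comp, Submodule.range_subtype, Submodule.map_sup,
      Submodule.mkQ_map_self, bot_sup_eq]
  rw [relLength_eq_length_map, ← hr, ← (LinearMap.quotKerEquivRange _).length_eq]
  exact (Submodule.quotEquivOfEq _ _ hk).length_eq

theorem relLength_sup (X Y : Submodule R T) :
    relLength (Y ⊔ X) Y = relLength X (X ⊓ Y) := by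
  simpa using relLength_sup_map X Y LinearMap.id

theorem relLength_eq_add {X X' Y : Submodule R T} (h : X' ≤ X) (h' : Y ≤ X') :
    relLength X Y = relLength X' Y + relLength X X' := by
  refine Module.length_eq_add_of_exact
    (Submodule.mapQ (Y.comap X'.subtype) (Y.comap X.subtype) (Submodule.inclusion h)
      (show _ ≤ _ from fun z hz => hz))
    (Submodule.mapQ (Y.comap X.subtype) (X'.comap X.subtype) LinearMap.id
      (show _ ≤ _ from fun z hz => h' hz)) ?_ ?_ ?_
  · refine LinearMap.ker_eq_bot.1 ((Submodule.eq_bot_iff _).2 fun z hz => ?_)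
    obtain ⟨z, rfl⟩ := Submodule.mkQ_surjective _ z
    have hz' := (Submodule.Quotient.mk_eq_zero (Y.comap X.subtype)
      (x := Submodule.inclusion h z)).1 hz
    exact (Submodule.Quotient.mk_eq_zero (Y.comap X'.subtype)).2 hz'
  · intro z
    obtain ⟨z, rfl⟩ := Submodule.mkQ_surjective _ z
    exact ⟨Submodule.Quotient.mk z, rfl⟩
  · intro z
    obtain ⟨z, rfl⟩ := Submodule.mkQ_surjective _ z
    simp only [Submodule.mkQ_apply, Submodule.mapQ_apply, LinearMap.id_apply,
      Submodule.Quotient.mk_eq_zero]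
    constructor
    · intro hz
      exact ⟨Submodule.Quotient.mk ⟨z, hz⟩, rfl⟩
    · rintro ⟨w, hw⟩
      obtain ⟨w, rfl⟩ := Submodule.mkQ_surjective _ w
      have := (Submodule.Quotient.eq _).1 hw
      simp only [Submodule.mem_comap, Submodule.subtype_apply, Submodule.coe_sub,
        Submodule.coe_inclusion] at this ⊢
      have h2 := X'.sub_mem w.2 (h' this)
      simpa using h2

theorem relLength_eq_zero {X Y : Submodule R T} (h : X ≤ Y) : relLength X Y = 0 := by
  rw [relLength, Module.length_eq_zero_iff, subQuot, Submodule.Quotient.subsingleton_iff,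
    Submodule.comap_subtype_eq_top]
  exact h

end RelativeLength

section GradedFamily

open scoped Polynomial

variable {R B T γ : Type} [CommRing R] [CommRing B] [Algebra R B] [AddCommGroup T] [Module R T]
  [Module B T]

/-- A family of submodules indexed by bidegrees such that multiplication by `x c` maps the
component of bidegree `d` into that of bidegree `d + δ c`. -/
def IsStableFamily (x : γ → B) (δ : γ → ℕ × ℕ) (M : ℕ × ℕ → Submodule R T) : Prop :=
  ∀ c d z, z ∈ M d → x c • z ∈ M (d + δ c)

variable (B T) in
/-- Polynomials in two variables with coefficients in `T`. -/
abbrev BiPoly : Type := PolynomialModule B[X] (PolynomialModule B T)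

namespace BiPoly

/-- The coefficient of bidegree `d`. -/
noncomputable def bicoeff (g : BiPoly B T) (d : ℕ × ℕ) : T := (g.coeff d.1).coeff d.2

variable (B) in
/-- The polynomial whose only nonzero coefficient is `z`, in bidegree `d`. -/
noncomputable def bisingle (d : ℕ × ℕ) (z : T) : BiPoly B T :=
  PolynomialModule.single _ d.1 (PolynomialModule.single _ d.2 z)

/-- The monomial of bidegree `d` with coefficient `b`. -/
noncomputable def bimonomial (d : ℕ × ℕ) (b : B) : B[X][X] :=
  Polynomial.monomial d.1 (Polynomial.monomial d.2 b)

theorem bicoeff_bimonomial_smul (b : B) (e d : ℕ × ℕ) (g : BiPoly B T) :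
    bicoeff (bimonomial e b • g) d = if e ≤ d then b • bicoeff g (d - e) else 0 := by
  rw [bicoeff, bimonomial, PolynomialModule.monomial_smul_apply]
  by_cases h : e.1 ≤ d.1 <;> simp [h, bicoeff, Prod.le_def]

theorem bimonomial_smul_bisingle (b : B) (e d : ℕ × ℕ) (z : T) :
    bimonomial e b • bisingle B d z = bisingle B (e + d) (b • z) := by
  simp [bimonomial, bisingle]

theorem bicoeff_bisingle (d e : ℕ × ℕ) (z : T) :
    bicoeff (bisingle B d z) e = if d = e then z else 0 := by
  simp only [bicoeff, bisingle, PolynomialModule.coeff_single, Finsupp.single_apply, Prod.ext_iff]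
  by_cases h : d.1 = e.1 <;> simp [h, Finsupp.single_apply]

theorem bisingle_add (d : ℕ × ℕ) (z w : T) :
    bisingle B d (z + w) = bisingle B d z + bisingle B d w := by
  simp [bisingle]

theorem bisingle_zero (d : ℕ × ℕ) : bisingle B d (0 : T) = 0 := by
  simp [bisingle]

theorem bicoeff_add (g h : BiPoly B T) (d : ℕ × ℕ) :
    bicoeff (g + h) d = bicoeff g d + bicoeff h d := by
  simp [bicoeff]

/-- The bidegrees of nonzero coefficients are bounded. -/
theorem exists_bound (g : BiPoly B T) : ∃ k : ℕ, ∀ d, bicoeff g d ≠ 0 → d.1 ≤ k ∧ d.2 ≤ k := by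
  induction g using PolynomialModule.induction_linear with
  | zero => exact ⟨0, fun d h => absurd rfl h⟩
  | add g h hg hh =>
    obtain ⟨k, hk⟩ := hg
    obtain ⟨l, hl⟩ := hh
    refine ⟨max k l, fun d hd => ?_⟩
    rw [bicoeff_add] at hd
    by_cases h0 : bicoeff g d = 0
    · have := hl d (by simpa [h0] using hd)
      exact ⟨this.1.trans (le_max_right _ _), this.2.trans (le_max_right _ _)⟩
    · have := hk d h0
      exact ⟨this.1.trans (le_max_left _ _), this.2.trans (le_max_left _ _)⟩
  | single n g =>
    induction g using PolynomialModule.induction_linear with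
    | zero => exact ⟨0, fun d h => absurd (by simp [bicoeff]) h⟩
    | add g h hg hh =>
      obtain ⟨k, hk⟩ := hg
      obtain ⟨l, hl⟩ := hh
      refine ⟨max k l, fun d hd => ?_⟩
      rw [PolynomialModule.single_add, bicoeff_add] at hd
      by_cases h0 : bicoeff (PolynomialModule.single B[X] n g) d = 0
      · have := hl d (by simpa [h0] using hd)
        exact ⟨this.1.trans (le_max_right _ _), this.2.trans (le_max_right _ _)⟩
      · have := hk d h0
        exact ⟨this.1.trans (le_max_left _ _), this.2.trans (le_max_left _ _)⟩
    | single m z =>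
      refine ⟨max n m, fun d hd => ?_⟩
      have h := bicoeff_bisingle (B := B) (n, m) d z
      replace hd : bicoeff (bisingle B (n, m) z) d ≠ 0 := hd
      rw [h] at hd
      have : (n, m) = d := by
        by_contra hne
        exact hd (if_neg hne)
      subst this
      exact ⟨le_max_left _ _, le_max_right _ _⟩

end BiPoly

open BiPoly

variable (R) in
/-- The algebra generated by the `x c`, placed in bidegrees `δ c`. -/
noncomputable abbrev gradedAdjoin (x : γ → B) (δ : γ → ℕ × ℕ) : Subalgebra R B[X][X] :=
  Algebra.adjoin R (Set.range fun c => bimonomial (δ c) (x c))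

theorem isNoetherianRing_gradedAdjoin [IsNoetherianRing R] [Finite γ] (x : γ → B)
    (δ : γ → ℕ × ℕ) : IsNoetherianRing (gradedAdjoin R x δ) :=
  isNoetherianRing_of_fg (Subalgebra.fg_def.2 ⟨_, Set.finite_range _, rfl⟩)

/-- A family contained in a finitely generated graded module over `gradedAdjoin R x δ`. -/
def IsFGBoundedFamily (x : γ → B) (δ : γ → ℕ × ℕ) (F : ℕ × ℕ → Submodule R T) : Prop :=
  ∃ Q : Submodule (gradedAdjoin R x δ) (BiPoly B T), Q.FG ∧ ∀ d, ∀ z ∈ F d, bisingle B d z ∈ Q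

theorem IsFGBoundedFamily.mono {x : γ → B} {δ : γ → ℕ × ℕ} {F M : ℕ × ℕ → Submodule R T}
    (hF : IsFGBoundedFamily x δ F) (h : M ≤ F) : IsFGBoundedFamily x δ M := by
  obtain ⟨Q, hQ, hFQ⟩ := hF
  exact ⟨Q, hQ, fun d z hz => hFQ d z (h d hz)⟩

variable [IsScalarTower R B T]

theorem algebraMap_eq_bimonomial (r : R) :
    algebraMap R B[X][X] r = bimonomial 0 (algebraMap R B r) := rfl

/-- The polynomials whose coefficients lie in the members of a stable family. -/
noncomputable def IsStableFamily.submodule {x : γ → B} {δ : γ → ℕ × ℕ} {M : ℕ × ℕ → Submodule R T}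
    (hM : IsStableFamily x δ M) : Submodule (gradedAdjoin R x δ) (BiPoly B T) where
  carrier := {g | ∀ d, bicoeff g d ∈ M d}
  zero_mem' d := (M d).zero_mem
  add_mem' {g h} hg hh d := by
    rw [bicoeff_add]
    exact (M d).add_mem (hg d) (hh d)
  smul_mem' := by
    rintro ⟨a, ha⟩
    change ∀ g : BiPoly B T, (∀ d, bicoeff g d ∈ M d) → ∀ d, bicoeff (a • g) d ∈ M d
    induction ha using Algebra.adjoin_induction with
    | mem a ha =>
      obtain ⟨c, rfl⟩ := ha
      intro g hg d
      simp only [bicoeff_bimonomial_smul]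
      split_ifs with h
      · have := hM c _ _ (hg (d - δ c))
        rwa [tsub_add_cancel_of_le h] at this
      · exact zero_mem _
    | algebraMap r =>
      intro g hg d
      rw [algebraMap_eq_bimonomial, bicoeff_bimonomial_smul, if_pos (by simp), tsub_zero,
        algebraMap_smul]
      exact (M d).smul_mem r (hg d)
    | add a b _ _ ha hb =>
      intro g hg d
      rw [add_smul, bicoeff_add]
      exact (M d).add_mem (ha g hg d) (hb g hg d)
    | mul a b _ _ ha hb =>
      intro g hg
      rw [mul_smul]
      exact ha _ (hb g hg)

theorem bisingle_decomposition {Q : AddSubmonoid (BiPoly B T)} {g : BiPoly B T}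
    (h : ∀ d, bisingle B d (bicoeff g d) ∈ Q) : g ∈ Q := by
  have hg : g = ∑ m ∈ g.coeff.support, ∑ n ∈ (g.coeff m).coeff.support,
      bisingle B (m, n) (bicoeff g (m, n)) := by
    apply PolynomialModule.ext
    conv_lhs => rw [← Finsupp.sum_single g.coeff]
    rw [PolynomialModule.coeff_sum]
    refine Finset.sum_congr rfl fun m _ => ?_
    rw [PolynomialModule.coeff_sum]
    simp only [bisingle, PolynomialModule.coeff_single]
    rw [← Finsupp.single_finsetSum]
    congr 1
    apply PolynomialModule.ext
    rw [PolynomialModule.coeff_sum]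
    conv_lhs => rw [← Finsupp.sum_single (g.coeff m).coeff]
    rfl
  rw [hg]
  exact sum_mem fun m _ => sum_mem fun n _ => h _

/-- Beyond some degree, a stable family is generated by multiplication by the operators of
bidegree `e`, where `e` is the unit vector detected by the coordinate `π`. -/
theorem IsStableFamily.exists_generated [IsNoetherianRing R] [Finite γ] {x : γ → B}
    {δ : γ → ℕ × ℕ} {M : ℕ × ℕ → Submodule R T} (hM : IsStableFamily x δ M)
    (hF : IsFGBoundedFamily x δ M) (π : ℕ × ℕ →+ ℕ) (hπ : ∀ d, π d ≤ d.1 + d.2) (e : ℕ × ℕ)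
    (hδ : ∀ c, δ c = e ∨ π (δ c) = 0) :
    ∃ k, ∀ d, k < π d → M d ≤ ⨆ c, ⨆ (_ : δ c = e), ⨆ a, ⨆ (_ : a + e = d),
      (M a).map (Algebra.lsmul R R T (x c)) := by
  obtain ⟨Q, hQ, hMQ⟩ := hF
  have := isNoetherianRing_gradedAdjoin (R := R) x δ
  have hMQ' : hM.submodule ≤ Q := fun g hg =>
    bisingle_decomposition (Q := Q.toAddSubmonoid) fun d => hMQ d _ (hg d)
  obtain ⟨S, hS⟩ : hM.submodule.FG :=
    Submodule.FG.of_le (R := gradedAdjoin R x δ) (M := BiPoly B T) hQ hMQ'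
  choose b hb using fun g : BiPoly B T => g.exists_bound
  let k := S.sup b
  let G : ℕ × ℕ → Submodule R T := fun d => ⨆ c, ⨆ (_ : δ c = e), ⨆ a, ⨆ (_ : a + e = d),
      (M a).map (Algebra.lsmul R R T (x c))
  let L : ℕ × ℕ → Submodule R T := fun d => if π d ≤ k + k then M d else ⊥
  have hGM : G ≤ M := by
    intro d
    refine iSup_le fun c => iSup_le fun hc => iSup_le fun a => iSup_le fun ha => ?_
    rintro _ ⟨z, hz, rfl⟩
    have := hM c a z hz
    rwa [hc, ha] at this
  have hLM : L ≤ M := by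
    intro d
    simp only [L]
    split_ifs
    · exact le_rfl
    · exact bot_le
  have hG : ∀ c d z, δ c = e → z ∈ M d → x c • z ∈ G (d + e) := by
    intro c d z hc hz
    refine Submodule.mem_iSup_of_mem c (Submodule.mem_iSup_of_mem hc
      (Submodule.mem_iSup_of_mem d (Submodule.mem_iSup_of_mem rfl ?_)))
    exact Submodule.mem_map_of_mem (f := (Algebra.lsmul R R T (x c))) hz
  have hH : IsStableFamily x δ (fun d => L d ⊔ G d) := by
    intro c d z hz
    rcases hδ c with hc | hc
    · rw [hc]
      exact Submodule.mem_sup_right (hG c d z hc (sup_le (hLM d) (hGM d) hz))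
    · obtain ⟨u, hu, v, hv, rfl⟩ := Submodule.mem_sup.1 hz
      rw [smul_add]
      refine Submodule.add_mem_sup ?_ ?_
      · simp only [L, map_add, hc, add_zero] at hu ⊢
        split_ifs at hu ⊢
        · exact hM c d u hu
        · simp [(Submodule.mem_bot R).1 hu]
      · have : G d ≤ (G (d + δ c)).comap (Algebra.lsmul R R T (x c)) := by
          refine iSup_le fun c' => iSup_le fun hc' => iSup_le fun a => iSup_le fun ha => ?_
          rintro _ ⟨w, hw, rfl⟩
          change x c • x c' • w ∈ G (d + δ c)
          rw [smul_comm, ← ha, add_right_comm]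
          exact hG c' _ _ hc' (hM c a w hw)
        exact this hv
  have hMH : hM.submodule ≤ hH.submodule := by
    rw [← hS, Submodule.span_le]
    intro g hg d
    by_cases h0 : bicoeff g d = 0
    · rw [h0]
      exact zero_mem _
    · have h1 := hb g d h0
      have h2 : b g ≤ k := Finset.le_sup (f := b) hg
      have h3 : g ∈ hM.submodule := by
        rw [← hS]
        exact Submodule.subset_span hg
      refine Submodule.mem_sup_left ?_
      have : π d ≤ k + k := (hπ d).trans (add_le_add (h1.1.trans h2) (h1.2.trans h2))
      simp only [L, if_pos this]
      exact h3 d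
  refine ⟨k + k, fun d hd z hz => ?_⟩
  have hz' : bisingle B d z ∈ hM.submodule := by
    intro a
    rw [bicoeff_bisingle]
    split_ifs with h
    · exact h ▸ hz
    · exact zero_mem _
  have := hMH hz' d
  rw [bicoeff_bisingle, if_pos rfl] at this
  simpa only [L, if_neg (not_le.2 hd), bot_sup_eq] using this

end GradedFamily

section HilbertPolynomial

variable {R B T γ : Type} [CommRing R] [CommRing B] [Algebra R B] [AddCommGroup T] [Module R T]
  [Module B T] [IsScalarTower R B T] {x : γ → B} {δ : γ → ℕ × ℕ} {M N : ℕ × ℕ → Submodule R T}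

/-- The kernel of multiplication by `x c` on the quotient of `M` by `N`. -/
def kernelFamily (x : γ → B) (δ : γ → ℕ × ℕ) (M N : ℕ × ℕ → Submodule R T) (c : γ) (d : ℕ × ℕ) :
    Submodule R T :=
  M d ⊓ (N (d + δ c)).comap (Algebra.lsmul R R T (x c))

/-- The family generated by `N` and the image of `M` under multiplication by `x c`. -/
def imageFamily (x : γ → B) (δ : γ → ℕ × ℕ) (M N : ℕ × ℕ → Submodule R T) (c : γ) (d : ℕ × ℕ) :
    Submodule R T :=
  N d ⊔ ⨆ a, ⨆ (_ : a + δ c = d), (M a).map (Algebra.lsmul R R T (x c))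

theorem imageFamily_add (c : γ) (d : ℕ × ℕ) :
    imageFamily x δ M N c (d + δ c) =
      N (d + δ c) ⊔ (M d).map (Algebra.lsmul R R T (x c)) := by
  rw [imageFamily]
  congr 1
  refine le_antisymm (iSup_le fun a => iSup_le fun h => ?_) (le_iSup₂_of_le d rfl le_rfl)
  rw [add_right_cancel h]

theorem kernelFamily_stable (hM : IsStableFamily x δ M) (hN : IsStableFamily x δ N) (c : γ) :
    IsStableFamily x δ (kernelFamily x δ M N c) := by
  intro c' d z hz
  refine ⟨hM c' d z hz.1, ?_⟩
  have := hN c' _ _ hz.2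
  rw [add_right_comm] at this
  change x c' • x c • z ∈ _ at this
  rwa [smul_comm] at this

theorem imageFamily_stable (hM : IsStableFamily x δ M) (hN : IsStableFamily x δ N) (c : γ) :
    IsStableFamily x δ (imageFamily x δ M N c) := by
  intro c' d
  suffices h : imageFamily x δ M N c d ≤
      (imageFamily x δ M N c (d + δ c')).comap (Algebra.lsmul R R T (x c')) from fun z hz => h hz
  refine sup_le (fun z hz => Submodule.mem_sup_left (hN c' d z hz)) ?_
  refine iSup_le fun a => iSup_le fun h => ?_
  rintro _ ⟨z, hz, rfl⟩
  refine Submodule.mem_sup_right (Submodule.mem_iSup_of_mem (a + δ c')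
    (Submodule.mem_iSup_of_mem (by rw [← h, add_right_comm]) ⟨x c' • z, hM c' a z hz, ?_⟩))
  exact smul_comm _ _ _

theorem imageFamily_le (hM : IsStableFamily x δ M) (hNM : N ≤ M) (c : γ) :
    imageFamily x δ M N c ≤ M := by
  refine fun d => sup_le (hNM d) (iSup_le fun a => iSup_le fun h => ?_)
  rintro _ ⟨z, hz, rfl⟩
  exact h ▸ hM c a z hz

theorem le_kernelFamily (hN : IsStableFamily x δ N) (hNM : N ≤ M) (c : γ) :
    N ≤ kernelFamily x δ M N c := fun d z hz => ⟨hNM d hz, hN c d z hz⟩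

theorem kernelFamily_le (c : γ) : kernelFamily x δ M N c ≤ M := fun _ => inf_le_left

theorem relLength_add_relLength_kernelFamily (hM : IsStableFamily x δ M)
    (hN : IsStableFamily x δ N) (hNM : N ≤ M) (c : γ) (d : ℕ × ℕ) :
    relLength (M (d + δ c)) (N (d + δ c)) + relLength (kernelFamily x δ M N c d) (N d) =
      relLength (M d) (N d) +
        relLength (M (d + δ c)) (imageFamily x δ M N c (d + δ c)) := by
  rw [relLength_eq_add (kernelFamily_le c d) (le_kernelFamily hN hNM c d),
    relLength_eq_add (imageFamily_le hM hNM c (d + δ c)) (show N (d + δ c) ≤ _ from le_sup_left),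
    imageFamily_add, relLength_sup_map, kernelFamily]
  ring

theorem relLength_left_ne_top {X X' Y : Submodule R T} (h : X' ≤ X) (h' : Y ≤ X')
    (hfin : relLength X Y ≠ ⊤) : relLength X' Y ≠ ⊤ := by
  rw [relLength_eq_add h h'] at hfin
  exact (WithTop.add_ne_top.1 hfin).1

theorem relLength_right_ne_top {X X' Y : Submodule R T} (h : X' ≤ X) (h' : Y ≤ X')
    (hfin : relLength X Y ≠ ⊤) : relLength X X' ≠ ⊤ := by
  rw [relLength_eq_add h h'] at hfin
  exact (WithTop.add_ne_top.1 hfin).2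

/-- If no operator of bidegree `e` acts nontrivially on `M / N`, then `M / N` vanishes beyond some
degree in the direction of `e`. -/
theorem exists_le_of_smul_mem [IsNoetherianRing R] [Finite γ] (hM : IsStableFamily x δ M)
    (hF : IsFGBoundedFamily x δ M) (π : ℕ × ℕ →+ ℕ) (hπ : ∀ d, π d ≤ d.1 + d.2) (e : ℕ × ℕ)
    (hδ : ∀ c, δ c = e ∨ π (δ c) = 0)
    (hk : ∀ c, δ c = e → ∀ d, ∀ z ∈ M d, x c • z ∈ N (d + δ c)) :
    ∃ k, ∀ d, k < π d → M d ≤ N d := by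
  obtain ⟨k, hk'⟩ := hM.exists_generated hF π hπ e hδ
  refine ⟨k, fun d hd => (hk' d hd).trans ?_⟩
  refine iSup_le fun c => iSup_le fun hc => iSup_le fun a => iSup_le fun ha => ?_
  rintro _ ⟨z, hz, rfl⟩
  have := hk c hc a z hz
  rwa [hc, ha] at this

theorem eventuallyPolynomial_relLength_of_smul_mem [IsNoetherianRing R] [Finite γ]
    (hδ : ∀ c, δ c = (1, 0) ∨ δ c = (0, 1)) (S : Finset γ) :
    ∀ M N : ℕ × ℕ → Submodule R T, IsStableFamily x δ M → IsStableFamily x δ N → N ≤ M →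
    IsFGBoundedFamily x δ M → (∀ c ∉ S, ∀ d, ∀ z ∈ M d, x c • z ∈ N (d + δ c)) →
    (∀ᶠ d in atTop, relLength (M d) (N d) ≠ ⊤) →
    EventuallyPolynomial fun d => ((relLength (M d) (N d)).toNat : ℚ) := by
  classical
  induction S using Finset.strongInduction with
  | H S ih =>
  intro M N hM hN hNM hF hk hfin
  have step : ∀ c ∈ S, EventuallyPolynomial fun d =>
      ((relLength (M (d + δ c)) (N (d + δ c))).toNat : ℚ) - (relLength (M d) (N d)).toNat := by
    intro c hc
    have hK := ih (S.erase c) (Finset.erase_ssubset hc) (kernelFamily x δ M N c) N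
      (kernelFamily_stable hM hN c) hN (le_kernelFamily hN hNM c) (hF.mono (kernelFamily_le c))
      (fun c' hc' d z hz => by
        by_cases h : c' = c
        · subst h
          exact hz.2
        · exact hk c' (fun h' => hc' (Finset.mem_erase.2 ⟨h, h'⟩)) d z hz.1)
      (by
        filter_upwards [hfin] with d hd
        exact relLength_left_ne_top (kernelFamily_le c d) (le_kernelFamily hN hNM c d) hd)
    have hI := ih (S.erase c) (Finset.erase_ssubset hc) M (imageFamily x δ M N c)
      hM (imageFamily_stable hM hN c) (imageFamily_le hM hNM c) hF
      (fun c' hc' d z hz => by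
        by_cases h : c' = c
        · subst h
          rw [imageFamily_add]
          exact Submodule.mem_sup_right ⟨z, hz, rfl⟩
        · exact Submodule.mem_sup_left
            (hk c' (fun h' => hc' (Finset.mem_erase.2 ⟨h, h'⟩)) d z hz))
      (by
        filter_upwards [hfin] with d hd
        exact relLength_right_ne_top (imageFamily_le hM hNM c d) le_sup_left hd)
    refine ((hI.comp_add (δ c)).sub hK).congr ?_
    filter_upwards [hfin, (tendsto_add_right_atTop_prod (δ c)).eventually hfin] with d h₁ h₂
    have h₃ := relLength_left_ne_top (kernelFamily_le c d) (le_kernelFamily hN hNM c d) h₁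
    have h₄ := relLength_right_ne_top (imageFamily_le hM hNM c (d + δ c))
      (show N (d + δ c) ≤ _ from le_sup_left) h₂
    have h := congrArg ENat.toNat (relLength_add_relLength_kernelFamily hM hN hNM c d)
    rw [ENat.toNat_add h₂ h₃, ENat.toNat_add h₁ h₄] at h
    have h' : ((_ + _ : ℕ) : ℚ) = ((_ + _ : ℕ) : ℚ) := congrArg Nat.cast h
    push_cast at h'
    linarith
  by_cases h₁ : ∃ c ∈ S, δ c = (1, 0)
  · by_cases h₂ : ∃ c ∈ S, δ c = (0, 1)
    · obtain ⟨c₁, hc₁, e₁⟩ := h₁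
      obtain ⟨c₂, hc₂, e₂⟩ := h₂
      have s₁ := step c₁ hc₁
      have s₂ := step c₂ hc₂
      rw [e₁] at s₁
      rw [e₂] at s₂
      exact .of_differences s₁ s₂
    · obtain ⟨k, hk⟩ := exists_le_of_smul_mem hM hF (AddMonoidHom.snd ℕ ℕ) (by simp) (0, 1)
        (fun c => (hδ c).symm.imp_right fun h => by simp [h])
        fun c hc => hk c fun h => h₂ ⟨c, h, hc⟩
      refine EventuallyPolynomial.zero.congr ?_
      filter_upwards [eventually_ge_atTop ((0, k + 1) : ℕ × ℕ)] with d hd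
      simp [relLength_eq_zero (hk d hd.2)]
  · obtain ⟨k, hk⟩ := exists_le_of_smul_mem hM hF (AddMonoidHom.fst ℕ ℕ) (by simp) (1, 0)
      (fun c => (hδ c).imp_right fun h => by simp [h])
      fun c hc => hk c fun h => h₁ ⟨c, h, hc⟩
    refine EventuallyPolynomial.zero.congr ?_
    filter_upwards [eventually_ge_atTop ((k + 1, 0) : ℕ × ℕ)] with d hd
    simp [relLength_eq_zero (hk d hd.1)]

/-- The bigraded Hilbert polynomial: the lengths of the components of a finitely generated bigraded
module over an algebra generated in bidegrees `(1, 0)` and `(0, 1)` are eventually polynomial. -/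
theorem eventuallyPolynomial_relLength [IsNoetherianRing R] [Finite γ]
    (hδ : ∀ c, δ c = (1, 0) ∨ δ c = (0, 1)) (hM : IsStableFamily x δ M)
    (hN : IsStableFamily x δ N) (hNM : N ≤ M) (hF : IsFGBoundedFamily x δ M)
    (hfin : ∀ᶠ d in atTop, relLength (M d) (N d) ≠ ⊤) :
    EventuallyPolynomial fun d => ((relLength (M d) (N d)).toNat : ℚ) := by
  have := Fintype.ofFinite γ
  exact eventuallyPolynomial_relLength_of_smul_mem hδ Finset.univ M N hM hN hNM hF
    (fun c hc => absurd (Finset.mem_univ c) hc) hfin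

end HilbertPolynomial

section StableOperations

variable {R B T γ : Type} [CommRing R] [CommRing B] [AddCommGroup T] [Module R T]
  [Module B T] {x : γ → B} {δ : γ → ℕ × ℕ} {M N : ℕ × ℕ → Submodule R T}

theorem IsStableFamily.inf (hM : IsStableFamily x δ M) (hN : IsStableFamily x δ N) :
    IsStableFamily x δ fun d => M d ⊓ N d :=
  fun c d z hz => ⟨hM c d z hz.1, hN c d z hz.2⟩

theorem IsStableFamily.sup (hM : IsStableFamily x δ M) (hN : IsStableFamily x δ N) :
    IsStableFamily x δ fun d => M d ⊔ N d := by
  intro c d z hz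
  obtain ⟨u, hu, v, hv, rfl⟩ := Submodule.mem_sup.1 hz
  rw [smul_add]
  exact Submodule.add_mem_sup (hM c d u hu) (hN c d v hv)

theorem IsStableFamily.comp_add (hM : IsStableFamily x δ M) (e : ℕ × ℕ) :
    IsStableFamily x δ fun d => M (d + e) := by
  intro c d z hz
  have := hM c _ z hz
  rwa [add_right_comm] at this

end StableOperations

section GradedModule

open MvPolynomial
open scoped Pointwise

variable {R T β : Type} [CommRing R] {r : ℕ} [AddCommGroup T] [Module (MvPolynomial (Fin r) R) T]

/-- The submodule `J ^ m V`. -/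
noncomputable abbrev powSMul (J : Ideal R) (V : Submodule (MvPolynomial (Fin r) R) T) (m : ℕ) :
    Submodule (MvPolynomial (Fin r) R) T :=
  J.map (algebraMap R (MvPolynomial (Fin r) R)) ^ m • V

theorem powSMul_mono (J : Ideal R) {V W : Submodule (MvPolynomial (Fin r) R) T} (h : W ≤ V)
    (m : ℕ) : powSMul J W m ≤ powSMul J V m :=
  Submodule.smul_mono le_rfl h

theorem powSMul_succ_le (J : Ideal R) (V : Submodule (MvPolynomial (Fin r) R) T) (m : ℕ) :
    powSMul J V (m + 1) ≤ powSMul J V m :=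
  Submodule.smul_mono (Ideal.pow_le_pow_right m.le_succ) le_rfl

variable [Module R T] {ℳ : ℕ → Submodule R T}

theorem decompose_X_smul [DirectSum.Decomposition ℳ]
    (hX : ∀ i n, ∀ z ∈ ℳ n, (X i : MvPolynomial (Fin r) R) • z ∈ ℳ (n + 1)) (i : Fin r) (z : T) :
    (∀ n, (DirectSum.decompose ℳ ((X i : MvPolynomial (Fin r) R) • z) (n + 1) : T) =
      (X i : MvPolynomial (Fin r) R) • (DirectSum.decompose ℳ z n : T)) ∧
    (DirectSum.decompose ℳ ((X i : MvPolynomial (Fin r) R) • z) 0 : T) = 0 := by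
  induction z using DirectSum.Decomposition.inductionOn ℳ with
  | zero => simp
  | @homogeneous k w =>
    have h := hX i k w w.2
    refine ⟨fun n => ?_, DirectSum.decompose_of_mem_ne ℳ h (by omega)⟩
    by_cases hn : k = n
    · subst hn
      rw [DirectSum.decompose_of_mem_same ℳ h, DirectSum.decompose_of_mem_same ℳ w.2]
    · rw [DirectSum.decompose_of_mem_ne ℳ h (by omega), DirectSum.decompose_of_mem_ne ℳ w.2 hn,
        smul_zero]
  | add u v hu hv =>
    refine ⟨fun n => ?_, ?_⟩
    · simp [smul_add, hu.1 n, hv.1 n]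
    · simp [smul_add, hu.2, hv.2]

variable [IsScalarTower R (MvPolynomial (Fin r) R) T]

/-- The variables of the polynomial ring together with the scalars `y j`. -/
noncomputable def gradedOp (r : ℕ) (y : β → R) : Fin r ⊕ β → MvPolynomial (Fin r) R :=
  Sum.elim X fun j => algebraMap R _ (y j)

/-- Variables have bidegree `(0, 1)` and scalars have bidegree `(1, 0)`. -/
def gradedOpDegree (r : ℕ) (β : Type) : Fin r ⊕ β → ℕ × ℕ :=
  Sum.elim (fun _ => (0, 1)) fun _ => (1, 0)

theorem gradedOpDegree_eq (c : Fin r ⊕ β) :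
    gradedOpDegree r β c = (1, 0) ∨ gradedOpDegree r β c = (0, 1) := by
  cases c
  · exact .inr rfl
  · exact .inl rfl

/-- The component of degree `n` of a submodule. -/
noncomputable abbrev degreePart (ℳ : ℕ → Submodule R T)
    (A : Submodule (MvPolynomial (Fin r) R) T) (n : ℕ) : Submodule R T :=
  A.restrictScalars R ⊓ ℳ n

theorem degreePart_mono {A A' : Submodule (MvPolynomial (Fin r) R) T} (h : A ≤ A') (n : ℕ) :
    degreePart ℳ A n ≤ degreePart ℳ A' n :=
  inf_le_inf_right _ h

theorem stable_degreePart (hX : ∀ i n, ∀ z ∈ ℳ n, (X i : MvPolynomial (Fin r) R) • z ∈ ℳ (n + 1))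
    (y : β → R) (A : Submodule (MvPolynomial (Fin r) R) T) :
    IsStableFamily (gradedOp r y) (gradedOpDegree r β) fun d => degreePart ℳ A d.2 := by
  rintro (i | j) d z hz
  · exact ⟨A.smul_mem _ hz.1, hX i _ z hz.2⟩
  · refine ⟨A.smul_mem _ hz.1, ?_⟩
    change algebraMap R (MvPolynomial (Fin r) R) (y j) • z ∈ ℳ d.2
    rw [algebraMap_smul]
    exact (ℳ d.2).smul_mem _ hz.2

theorem stable_degreePart_powSMul
    (hX : ∀ i n, ∀ z ∈ ℳ n, (X i : MvPolynomial (Fin r) R) • z ∈ ℳ (n + 1))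
    {y : β → R} {J : Ideal R} (hy : ∀ j, y j ∈ J) (V : Submodule (MvPolynomial (Fin r) R) T) :
    IsStableFamily (gradedOp r y) (gradedOpDegree r β)
      fun d => degreePart ℳ (powSMul J V d.1) d.2 := by
  rintro (i | j) d z hz
  · exact stable_degreePart hX y (powSMul J V d.1) (.inl i) d z hz
  · refine ⟨?_, (stable_degreePart hX y (powSMul J V d.1) (.inr j) d z hz).2⟩
    change algebraMap R (MvPolynomial (Fin r) R) (y j) • z ∈ powSMul J V (d.1 + 1)
    rw [powSMul, pow_succ', Submodule.mul_smul]
    exact Submodule.smul_mem_smul (Ideal.mem_map_of_mem _ (hy j)) hz.1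

theorem homogeneous_powSMul (J : Ideal R) {V : Submodule (MvPolynomial (Fin r) R) T}
    (hV : ∃ s : Set T, (∀ x ∈ s, ∃ n, x ∈ ℳ n) ∧ V = Submodule.span _ s) (m : ℕ) :
    ∃ s : Set T, (∀ x ∈ s, ∃ n, x ∈ ℳ n) ∧ powSMul J V m = Submodule.span _ s := by
  obtain ⟨s, hs, rfl⟩ := hV
  refine ⟨algebraMap R (MvPolynomial (Fin r) R) '' (J ^ m : Ideal R) • s, ?_, ?_⟩
  · intro z hz
    obtain ⟨_, ⟨a, ha, rfl⟩, v, hv, rfl⟩ := Set.mem_smul.1 hz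
    obtain ⟨n, hn⟩ := hs v hv
    refine ⟨n, ?_⟩
    rw [algebraMap_smul]
    exact (ℳ n).smul_mem a hn
  · rw [powSMul, ← Ideal.map_pow, Ideal.map, Submodule.span_smul_span]

variable [DirectSum.Decomposition ℳ]

/-- The submodule of elements whose components lie in given `R`-submodules. -/
def componentwise (hX : ∀ i n, ∀ z ∈ ℳ n, (X i : MvPolynomial (Fin r) R) • z ∈ ℳ (n + 1))
    (C : ℕ → Submodule R T)
    (hC : ∀ i n, ∀ z ∈ C n, (X i : MvPolynomial (Fin r) R) • z ∈ C (n + 1)) :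
    Submodule (MvPolynomial (Fin r) R) T where
  carrier := {z | ∀ n, (DirectSum.decompose ℳ z n : T) ∈ C n}
  zero_mem' n := by simp
  add_mem' {a b} ha hb n := by
    simpa using (C n).add_mem (ha n) (hb n)
  smul_mem' p := by
    change ∀ z : T, (∀ n, (DirectSum.decompose ℳ z n : T) ∈ C n) →
      ∀ n, (DirectSum.decompose ℳ (p • z) n : T) ∈ C n
    induction p using MvPolynomial.induction_on with
    | C a =>
      intro z hz n
      rw [← algebraMap_eq, algebraMap_smul, DirectSum.decompose_smul]
      exact (C n).smul_mem a (hz n)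
    | add p q hp hq =>
      intro z hz n
      rw [add_smul, DirectSum.decompose_add]
      exact (C n).add_mem (hp z hz n) (hq z hz n)
    | mul_X p i hp =>
      intro z hz n
      rw [mul_smul]
      refine hp _ (fun k => ?_) n
      cases k with
      | zero =>
        rw [(decompose_X_smul hX i z).2]
        exact zero_mem _
      | succ k =>
        rw [(decompose_X_smul hX i z).1]
        exact hC i k _ (hz k)

theorem decompose_mem_of_homogeneous
    (hX : ∀ i n, ∀ z ∈ ℳ n, (X i : MvPolynomial (Fin r) R) • z ∈ ℳ (n + 1))
    {A : Submodule (MvPolynomial (Fin r) R) T}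
    (hA : ∃ s : Set T, (∀ x ∈ s, ∃ n, x ∈ ℳ n) ∧ A = Submodule.span _ s) {z : T} (hz : z ∈ A)
    (n : ℕ) : (DirectSum.decompose ℳ z n : T) ∈ A := by
  obtain ⟨s, hs, hA⟩ := hA
  have hle : A ≤ componentwise hX (fun _ => A.restrictScalars R)
      fun i n z hz => A.smul_mem _ hz := by
    conv_lhs => rw [hA]
    refine Submodule.span_le.2 fun w hw k => ?_
    obtain ⟨l, hl⟩ := hs w hw
    have hwA : w ∈ A := by
      rw [hA]
      exact Submodule.subset_span hw
    by_cases h : l = k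
    · subst h
      rwa [DirectSum.decompose_of_mem_same ℳ hl]
    · rw [DirectSum.decompose_of_mem_ne ℳ hl h]
      exact zero_mem _
  exact hle hz n

theorem degreePart_sup
    (hX : ∀ i n, ∀ z ∈ ℳ n, (X i : MvPolynomial (Fin r) R) • z ∈ ℳ (n + 1))
    {A A' : Submodule (MvPolynomial (Fin r) R) T}
    (hA : ∃ s : Set T, (∀ x ∈ s, ∃ n, x ∈ ℳ n) ∧ A = Submodule.span _ s)
    (hA' : ∃ s : Set T, (∀ x ∈ s, ∃ n, x ∈ ℳ n) ∧ A' = Submodule.span _ s) (n : ℕ) :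
    degreePart ℳ (A ⊔ A') n = degreePart ℳ A n ⊔ degreePart ℳ A' n := by
  refine le_antisymm ?_ (sup_le (inf_le_inf_right _ fun z hz => Submodule.mem_sup_left hz)
    (inf_le_inf_right _ fun z hz => Submodule.mem_sup_right hz))
  rintro z ⟨hz, hzn⟩
  obtain ⟨a, ha, b, hb, rfl⟩ := Submodule.mem_sup.1 hz
  rw [← DirectSum.decompose_of_mem_same ℳ hzn, DirectSum.decompose_add]
  exact Submodule.add_mem_sup ⟨decompose_mem_of_homogeneous hX hA ha n, SetLike.coe_mem _⟩
    ⟨decompose_mem_of_homogeneous hX hA' hb n, SetLike.coe_mem _⟩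

theorem bisingle_smul_mem {B T γ : Type} [CommRing B] [Algebra R B] [AddCommGroup T] [Module R T]
    [Module B T] [IsScalarTower R B T] {x : γ → B} {δ : γ → ℕ × ℕ}
    {Q : Submodule (gradedAdjoin R x δ) (BiPoly B T)} {d : ℕ × ℕ} {z : T}
    (hz : BiPoly.bisingle B d z ∈ Q) (a : R) : BiPoly.bisingle B d (a • z) ∈ Q := by
  have := Q.smul_mem ⟨_, Subalgebra.algebraMap_mem _ a⟩ hz
  rwa [Submonoid.mk_smul, algebraMap_eq_bimonomial, BiPoly.bimonomial_smul_bisingle, zero_add,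
    algebraMap_smul] at this

theorem bisingle_op_smul_mem {B T γ : Type} [CommRing B] [Algebra R B] [AddCommGroup T]
    [Module B T] {x : γ → B} {δ : γ → ℕ × ℕ}
    {Q : Submodule (gradedAdjoin R x δ) (BiPoly B T)} {d : ℕ × ℕ} {z : T}
    (hz : BiPoly.bisingle B d z ∈ Q) (c : γ) : BiPoly.bisingle B (d + δ c) (x c • z) ∈ Q := by
  have := Q.smul_mem ⟨_, Algebra.subset_adjoin ⟨c, rfl⟩⟩ hz
  rwa [Submonoid.mk_smul, BiPoly.bimonomial_smul_bisingle, add_comm] at this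

theorem isFGBoundedFamily_powSMul
    (hX : ∀ i n, ∀ z ∈ ℳ n, (X i : MvPolynomial (Fin r) R) • z ∈ ℳ (n + 1))
    {y : β → R} {J : Ideal R} (hy : Ideal.span (Set.range y) = J)
    {V : Submodule (MvPolynomial (Fin r) R) T} (hVfg : V.FG)
    (hV : ∃ s : Set T, (∀ x ∈ s, ∃ n, x ∈ ℳ n) ∧ V = Submodule.span _ s) :
    IsFGBoundedFamily (gradedOp r y) (gradedOpDegree r β)
      fun d => degreePart ℳ (powSMul J V d.1) d.2 := by
  obtain ⟨s, hs, rfl⟩ := hV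
  obtain ⟨t, hts, hst⟩ := (Submodule.fg_span_iff_fg_span_finset_subset s).1 hVfg
  choose! deg hdeg using hs
  let Q : Submodule (gradedAdjoin R (gradedOp r y) (gradedOpDegree r β))
      (BiPoly (MvPolynomial (Fin r) R) T) :=
    Submodule.span _ ((fun v => BiPoly.bisingle _ (0, deg v) v) '' t)
  refine ⟨Q, Submodule.fg_span (t.finite_toSet.image _), ?_⟩
  let C : ℕ → ℕ → Submodule R T := fun m n =>
    { carrier := {z | BiPoly.bisingle _ (m, n) z ∈ Q}
      zero_mem' := by
        change BiPoly.bisingle _ _ _ ∈ Q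
        rw [BiPoly.bisingle_zero]
        exact zero_mem _
      add_mem' := fun {a b} ha hb => by
        change BiPoly.bisingle _ _ _ ∈ Q
        rw [BiPoly.bisingle_add]
        exact add_mem ha hb
      smul_mem' := fun a z hz => by
        change BiPoly.bisingle _ _ _ ∈ Q at hz ⊢
        exact bisingle_smul_mem hz a }
  have hC : ∀ m i n, ∀ z ∈ C m n, (X i : MvPolynomial (Fin r) R) • z ∈ C m (n + 1) :=
    fun m i n z (hz : BiPoly.bisingle _ (m, n) z ∈ Q) => bisingle_op_smul_mem hz (.inl i)
  have hCy : ∀ j m n, ∀ z ∈ C m n, y j • z ∈ C (m + 1) n := by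
    intro j m n z hz
    change BiPoly.bisingle _ _ _ ∈ Q at hz
    have h := bisingle_op_smul_mem hz (.inr j)
    change BiPoly.bisingle _ _ (algebraMap R (MvPolynomial (Fin r) R) (y j) • z) ∈ Q at h
    rwa [algebraMap_smul] at h
  have hle : ∀ m, powSMul J (Submodule.span _ s) m ≤ componentwise hX (C m) (hC m) := by
    intro m
    induction m with
    | zero =>
      rw [powSMul, pow_zero, Ideal.one_eq_top, Submodule.top_smul, hst]
      refine Submodule.span_le.2 fun v hv n => ?_
      by_cases h : deg v = n
      · rw [← h, DirectSum.decompose_of_mem_same ℳ (hdeg v (hts hv))]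
        exact Submodule.subset_span ⟨v, hv, rfl⟩
      · rw [DirectSum.decompose_of_mem_ne ℳ (hdeg v (hts hv)) h]
        exact zero_mem _
    | succ m ih =>
      rw [powSMul, pow_succ', Submodule.mul_smul, Submodule.smul_le]
      intro a ha z hz
      rw [← hy, Ideal.map_span] at ha
      induction ha using Submodule.span_induction with
      | mem a ha =>
        obtain ⟨_, ⟨j, rfl⟩, rfl⟩ := ha
        intro n
        rw [algebraMap_smul, DirectSum.decompose_smul]
        exact hCy j m n _ (ih hz n)
      | zero => simp
      | add a b _ _ ha hb =>
        rw [add_smul]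
        exact add_mem ha hb
      | smul p a _ ha =>
        rw [smul_assoc]
        exact Submodule.smul_mem _ p ha
  rintro ⟨m, n⟩ z ⟨hz, hzn⟩
  have := hle m hz n
  rwa [DirectSum.decompose_of_mem_same ℳ hzn] at this

end GradedModule

section SumOfFamilies

open MvPolynomial

variable {R T : Type} [CommRing R] {r : ℕ} [AddCommGroup T] [Module R T]
  [Module (MvPolynomial (Fin r) R) T] [IsScalarTower R (MvPolynomial (Fin r) R) T]
  {ℳ : ℕ → Submodule R T} [DirectSum.Decomposition ℳ] {J : Ideal R}
  {U V W Z : Submodule (MvPolynomial (Fin r) R) T}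

theorem isFGBoundedFamily_degreePart
    (hX : ∀ i n, ∀ z ∈ ℳ n, (X i : MvPolynomial (Fin r) R) • z ∈ ℳ (n + 1)) (hUfg : U.FG)
    (hU : ∃ s : Set T, (∀ x ∈ s, ∃ n, x ∈ ℳ n) ∧ U = Submodule.span _ s) :
    IsFGBoundedFamily (gradedOp r fun _ : Unit => (1 : R)) (gradedOpDegree r Unit)
      fun d => degreePart ℳ U d.2 := by
  have h := isFGBoundedFamily_powSMul (y := fun _ : Unit => (1 : R)) (J := ⊤) hX
    (by rw [Set.range_const]; exact Ideal.span_singleton_one) hUfg hU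
  refine h.mono fun d => degreePart_mono (le_of_eq ?_) d.2
  rw [powSMul, Ideal.map_top, Ideal.top_pow, Submodule.top_smul]

variable [IsNoetherianRing R]

/-- The lengths of the components of `(U + J ^ m V) / (Z + J ^ m V)` are eventually polynomial. -/
theorem eventuallyPolynomial_relLength_sup_powSMul
    (hX : ∀ i n, ∀ z ∈ ℳ n, (X i : MvPolynomial (Fin r) R) • z ∈ ℳ (n + 1))
    (hUfg : U.FG) (hVfg : V.FG)
    (hU : ∃ s : Set T, (∀ x ∈ s, ∃ n, x ∈ ℳ n) ∧ U = Submodule.span _ s)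
    (hV : ∃ s : Set T, (∀ x ∈ s, ∃ n, x ∈ ℳ n) ∧ V = Submodule.span _ s) (hZU : Z ≤ U)
    (hfin : ∀ᶠ d : ℕ × ℕ in atTop,
      relLength (degreePart ℳ U d.2 ⊔ degreePart ℳ (powSMul J V d.1) d.2)
        (degreePart ℳ Z d.2 ⊔ degreePart ℳ (powSMul J V d.1) d.2) ≠ ⊤) :
    EventuallyPolynomial fun d =>
      ((relLength (degreePart ℳ U d.2 ⊔ degreePart ℳ (powSMul J V d.1) d.2)
        (degreePart ℳ Z d.2 ⊔ degreePart ℳ (powSMul J V d.1) d.2)).toNat : ℚ) := by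
  obtain ⟨s, hs⟩ := IsNoetherian.noetherian J
  have hy : Ideal.span (Set.range ((↑) : s → R)) = J := by
    rw [Subtype.range_coe_subtype, Finset.setOfPred_mem]
    exact hs
  have hyJ : ∀ j : s, (j : R) ∈ J := fun j => hy ▸ Ideal.subset_span ⟨j, rfl⟩
  let U' : ℕ × ℕ → Submodule R T := fun d => degreePart ℳ U d.2
  let Z' : ℕ × ℕ → Submodule R T := fun d => degreePart ℳ Z d.2
  let P : ℕ × ℕ → Submodule R T := fun d => degreePart ℳ (powSMul J V d.1) d.2
  have hZU' : Z' ≤ U' := fun d => degreePart_mono hZU d.2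
  have hPanti : ∀ d, P (d + (1, 0)) ≤ P d := fun d =>
    degreePart_mono (powSMul_succ_le J V d.1) d.2
  have hg : ∀ d, relLength (U' d ⊔ P d) (Z' d ⊔ P d) = relLength (U' d) (U' d ⊓ (Z' d ⊔ P d)) := by
    intro d
    rw [← relLength_sup]
    congr 1
    rw [sup_right_comm, sup_eq_right.2 (hZU' d)]
  change EventuallyPolynomial fun d => ((relLength (U' d ⊔ P d) (Z' d ⊔ P d)).toNat : ℚ)
  change ∀ᶠ d in atTop, relLength (U' d ⊔ P d) (Z' d ⊔ P d) ≠ ⊤ at hfin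
  simp only [hg] at hfin ⊢
  have hsplit : ∀ d, relLength (U' (d + (1, 0)))
      (U' (d + (1, 0)) ⊓ (Z' (d + (1, 0)) ⊔ P (d + (1, 0)))) =
      relLength (U' d ⊓ P d) (U' d ⊓ P d ⊓ (U' d ⊓ (Z' d ⊔ P (d + (1, 0))))) +
        relLength (U' d) (U' d ⊓ (Z' d ⊔ P d)) := by
    intro d
    have h₁ : U' d ⊓ (Z' d ⊔ P (d + (1, 0))) ≤ U' d ⊓ (Z' d ⊔ P d) :=
      inf_le_inf_left _ (sup_le_sup_left (hPanti d) _)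
    have h₂ : U' d ⊓ (Z' d ⊔ P d) = U' d ⊓ (Z' d ⊔ P (d + (1, 0))) ⊔ U' d ⊓ P d := by
      refine le_antisymm ?_ (sup_le h₁ (inf_le_inf_left _ le_sup_right))
      rw [inf_comm, sup_inf_assoc_of_le _ (hZU' d), inf_comm (P d)]
      exact sup_le_sup_right (le_inf (hZU' d) le_sup_left) _
    rw [← relLength_sup (U' d ⊓ P d), ← h₂]
    exact relLength_eq_add inf_le_left h₁
  have hfin' := (tendsto_add_right_atTop_prod (1, 0)).eventually hfin
  refine EventuallyPolynomial.of_fst_difference ?_ ?_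
  · have hU' := stable_degreePart hX ((↑) : s → R) U
    have hZ' := stable_degreePart hX ((↑) : s → R) Z
    have hP := stable_degreePart_powSMul hX hyJ V
    have hM : IsStableFamily _ _ fun d => U' d ⊓ P d := hU'.inf hP
    have hN : IsStableFamily _ _ fun d => U' d ⊓ P d ⊓ (U' d ⊓ (Z' d ⊔ P (d + (1, 0)))) :=
      hM.inf (hU'.inf (hZ'.sup (hP.comp_add (1, 0))))
    refine (eventuallyPolynomial_relLength gradedOpDegree_eq hM hN (fun d => inf_le_left)
      ((isFGBoundedFamily_powSMul hX hy hVfg hV).mono fun d => inf_le_right) ?_).congr ?_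
    · filter_upwards [hfin'] with d hd
      rw [hsplit] at hd
      exact (WithTop.add_ne_top.1 hd).1
    · filter_upwards [hfin'] with d hd
      rw [hsplit] at hd ⊢
      rw [ENat.toNat_add (WithTop.add_ne_top.1 hd).1 (WithTop.add_ne_top.1 hd).2]
      push_cast
      ring
  · obtain ⟨⟨m₁, n₁⟩, h⟩ := eventually_atTop.1 hfin
    filter_upwards [eventually_ge_atTop m₁] with m hm
    have hU' := stable_degreePart hX (fun _ : Unit => (1 : R)) U
    have hZ' := stable_degreePart hX (fun _ : Unit => (1 : R)) Z
    have hP := stable_degreePart hX (fun _ : Unit => (1 : R)) (powSMul J V m)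
    refine eventuallyPolynomial_relLength gradedOpDegree_eq hU' (hU'.inf (hZ'.sup hP))
      (fun d => inf_le_left) (isFGBoundedFamily_degreePart hX hUfg hU) ?_
    filter_upwards [eventually_ge_atTop ((0, n₁) : ℕ × ℕ)] with d hd
    exact h (m, d.2) ⟨hm, hd.2⟩

/-- The lengths of the components of `(Z + J ^ m V) / (Z + J ^ m W)` are eventually polynomial. -/
theorem eventuallyPolynomial_relLength_powSMul_sup
    (hX : ∀ i n, ∀ z ∈ ℳ n, (X i : MvPolynomial (Fin r) R) • z ∈ ℳ (n + 1)) (hVfg : V.FG)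
    (hV : ∃ s : Set T, (∀ x ∈ s, ∃ n, x ∈ ℳ n) ∧ V = Submodule.span _ s) (hWV : W ≤ V)
    (hfin : ∀ᶠ d : ℕ × ℕ in atTop,
      relLength (degreePart ℳ Z d.2 ⊔ degreePart ℳ (powSMul J V d.1) d.2)
        (degreePart ℳ Z d.2 ⊔ degreePart ℳ (powSMul J W d.1) d.2) ≠ ⊤) :
    EventuallyPolynomial fun d =>
      ((relLength (degreePart ℳ Z d.2 ⊔ degreePart ℳ (powSMul J V d.1) d.2)
        (degreePart ℳ Z d.2 ⊔ degreePart ℳ (powSMul J W d.1) d.2)).toNat : ℚ) := by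
  obtain ⟨s, hs⟩ := IsNoetherian.noetherian J
  have hy : Ideal.span (Set.range ((↑) : s → R)) = J := by
    rw [Subtype.range_coe_subtype, Finset.setOfPred_mem]
    exact hs
  have hyJ : ∀ j : s, (j : R) ∈ J := fun j => hy ▸ Ideal.subset_span ⟨j, rfl⟩
  have hrel : ∀ d : ℕ × ℕ, relLength (degreePart ℳ Z d.2 ⊔ degreePart ℳ (powSMul J V d.1) d.2)
      (degreePart ℳ Z d.2 ⊔ degreePart ℳ (powSMul J W d.1) d.2) =
      relLength (degreePart ℳ (powSMul J V d.1) d.2) (degreePart ℳ (powSMul J V d.1) d.2 ⊓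
        (degreePart ℳ Z d.2 ⊔ degreePart ℳ (powSMul J W d.1) d.2)) := by
    intro d
    have h : degreePart ℳ (powSMul J W d.1) d.2 ≤ degreePart ℳ (powSMul J V d.1) d.2 :=
      degreePart_mono (powSMul_mono J hWV d.1) d.2
    rw [← relLength_sup, sup_assoc, sup_eq_right.2 h]
  simp only [hrel] at hfin ⊢
  have hP := stable_degreePart_powSMul hX hyJ V
  exact eventuallyPolynomial_relLength gradedOpDegree_eq hP
    (hP.inf ((stable_degreePart hX _ Z).sup (stable_degreePart_powSMul hX hyJ W)))
    (fun d => inf_le_left) (isFGBoundedFamily_powSMul hX hy hVfg hV) hfin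

/-- The lengths of the components of `(U + J ^ m V) / (Z + J ^ m W)` are eventually polynomial. -/
theorem eventuallyPolynomial_relLength_add_powSMul
    (hX : ∀ i n, ∀ z ∈ ℳ n, (X i : MvPolynomial (Fin r) R) • z ∈ ℳ (n + 1))
    (hUfg : U.FG) (hVfg : V.FG)
    (hU : ∃ s : Set T, (∀ x ∈ s, ∃ n, x ∈ ℳ n) ∧ U = Submodule.span _ s)
    (hV : ∃ s : Set T, (∀ x ∈ s, ∃ n, x ∈ ℳ n) ∧ V = Submodule.span _ s)
    (hW : ∃ s : Set T, (∀ x ∈ s, ∃ n, x ∈ ℳ n) ∧ W = Submodule.span _ s)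
    (hZ : ∃ s : Set T, (∀ x ∈ s, ∃ n, x ∈ ℳ n) ∧ Z = Submodule.span _ s)
    (hZU : Z ≤ U) (hWV : W ≤ V)
    (hfin : ∀ᶠ d : ℕ × ℕ in atTop,
      relLength (degreePart ℳ (U ⊔ powSMul J V d.1) d.2)
        (degreePart ℳ (Z ⊔ powSMul J W d.1) d.2) ≠ ⊤) :
    EventuallyPolynomial fun d =>
      ((relLength (degreePart ℳ (U ⊔ powSMul J V d.1) d.2)
        (degreePart ℳ (Z ⊔ powSMul J W d.1) d.2)).toNat : ℚ) := by
  simp only [degreePart_sup hX hU (homogeneous_powSMul J hV _),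
    degreePart_sup hX hZ (homogeneous_powSMul J hW _)] at hfin ⊢
  have h₁ : ∀ d : ℕ × ℕ, degreePart ℳ Z d.2 ⊔ degreePart ℳ (powSMul J V d.1) d.2 ≤
      degreePart ℳ U d.2 ⊔ degreePart ℳ (powSMul J V d.1) d.2 :=
    fun d => sup_le_sup_right (degreePart_mono hZU d.2) _
  have h₂ : ∀ d : ℕ × ℕ, degreePart ℳ Z d.2 ⊔ degreePart ℳ (powSMul J W d.1) d.2 ≤
      degreePart ℳ Z d.2 ⊔ degreePart ℳ (powSMul J V d.1) d.2 :=
    fun d => sup_le_sup_left (degreePart_mono (powSMul_mono J hWV d.1) d.2) _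
  simp only [fun d : ℕ × ℕ => relLength_eq_add (h₁ d) (h₂ d)] at hfin ⊢
  refine ((eventuallyPolynomial_relLength_powSMul_sup hX hVfg hV hWV
    (hfin.mono fun d hd => (WithTop.add_ne_top.1 hd).1)).add
    (eventuallyPolynomial_relLength_sup_powSMul hX hUfg hVfg hU hV hZU
    (hfin.mono fun d hd => (WithTop.add_ne_top.1 hd).2))).congr ?_
  filter_upwards [hfin] with d hd
  rw [ENat.toNat_add (WithTop.add_ne_top.1 hd).1 (WithTop.add_ne_top.1 hd).2, Nat.cast_add]

end SumOfFamilies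

theorem stmt12 (R : Type) [CommRing R] [IsNoetherianRing R] (J : Ideal R) (r : ℕ)
    -- `T` is a graded module over `S₁ = R[X₁, …, X_r]`, graded by total degree,
    -- with `n`-th homogeneous component `ℳ n`
    (T : Type) [AddCommGroup T] [Module R T]
    [Module (MvPolynomial (Fin r) R) T] [IsScalarTower R (MvPolynomial (Fin r) R) T]
    (ℳ : ℕ → Submodule R T)
    (hdec : DirectSum.IsInternal ℳ)
    (hsmul : ∀ (a b : ℕ) (p : MvPolynomial (Fin r) R) (x : T),
      p ∈ MvPolynomial.homogeneousSubmodule (Fin r) R a → x ∈ ℳ b → p • x ∈ ℳ (a + b))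
    -- `U`, `V`, `W`, `Z` are finitely generated graded submodules of `T`
    (U V W Z : Submodule (MvPolynomial (Fin r) R) T)
    (hUfg : U.FG) (hVfg : V.FG) (hWfg : W.FG) (hZfg : Z.FG)
    (hUgr : ∃ s : Set T, (∀ x ∈ s, ∃ n, x ∈ ℳ n) ∧ U = Submodule.span _ s)
    (hVgr : ∃ s : Set T, (∀ x ∈ s, ∃ n, x ∈ ℳ n) ∧ V = Submodule.span _ s)
    (hWgr : ∃ s : Set T, (∀ x ∈ s, ∃ n, x ∈ ℳ n) ∧ W = Submodule.span _ s)
    (hZgr : ∃ s : Set T, (∀ x ∈ s, ∃ n, x ∈ ℳ n) ∧ Z = Submodule.span _ s)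
    (hZU : Z ≤ U) (hWV : W ≤ V)
    -- the `n`-th homogeneous component of `L_m = (U + J^m V)/(Z + J^m W)` is the
    -- quotient of the degree-`n` parts; assume it has finite length for large `m`, `n`
    (hfin : ∃ m₁ n₁ : ℕ, ∀ m, m₁ ≤ m → ∀ n, n₁ ≤ n →
      IsFiniteLength R
        (subQuot R T
          ((U ⊔ (J.map (algebraMap R (MvPolynomial (Fin r) R))) ^ m • V).restrictScalars R ⊓ ℳ n)
          ((Z ⊔ (J.map (algebraMap R (MvPolynomial (Fin r) R))) ^ m • W).restrictScalars R ⊓ ℳ n))) :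
    ∃ (p : MvPolynomial (Fin 2) ℚ) (m₀ n₀ : ℕ), ∀ m, m₀ ≤ m → ∀ n, n₀ ≤ n →
      ∃ c : ℕ,
        modLength R
          (subQuot R T
            ((U ⊔ (J.map (algebraMap R (MvPolynomial (Fin r) R))) ^ m • V).restrictScalars R ⊓ ℳ n)
            ((Z ⊔ (J.map (algebraMap R (MvPolynomial (Fin r) R))) ^ m • W).restrictScalars R ⊓ ℳ n))
          = (c : ℕ∞) ∧
        (c : ℚ) = MvPolynomial.eval ![(m : ℚ), (n : ℚ)] p := by
  let _ := hdec.chooseDecomposition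
  have hX : ∀ i n, ∀ z ∈ ℳ n, (MvPolynomial.X i : MvPolynomial (Fin r) R) • z ∈ ℳ (n + 1) := by
    intro i n z hz
    rw [add_comm]
    exact hsmul 1 n _ z (MvPolynomial.isHomogeneous_X R i) hz
  obtain ⟨m₁, n₁, hfin⟩ := hfin
  have hfin' : ∀ᶠ d : ℕ × ℕ in Filter.atTop,
      relLength (degreePart ℳ (U ⊔ powSMul J V d.1) d.2)
        (degreePart ℳ (Z ⊔ powSMul J W d.1) d.2) ≠ ⊤ := by
    filter_upwards [Filter.eventually_ge_atTop (m₁, n₁)] with d hd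
    exact Module.length_ne_top_iff.2 (hfin d.1 hd.1 d.2 hd.2)
  obtain ⟨p, hp⟩ := eventuallyPolynomial_relLength_add_powSMul hX hUfg hVfg hUgr hVgr hWgr hZgr
    hZU hWV hfin'
  obtain ⟨⟨m₀, n₀⟩, h⟩ := Filter.eventually_atTop.1 (hp.and hfin')
  refine ⟨p, m₀, n₀, fun m hm n hn => ?_⟩
  obtain ⟨heq, hne⟩ := h (m, n) ⟨hm, hn⟩
  refine ⟨_, ?_, heq⟩
  rw [ENat.natCast_toNat hne, modLength, ← Module.coe_length]
  rfl
end

section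
/- Let (R,P) be a commutative Noetherian local ring, I an ideal of R, and A ⊆ B finitely generated R-modules. Fix k ≥ 0, and suppose that for all sufficiently large n the R-module I^{n−k}A/(I^{n−k}A ∩ I^n B) has finite length. Then there exist a polynomial p ∈ ℚ[x] and an integer n₀ such that length_R(I^{n−k}A/(I^{n−k}A ∩ I^n B)) = p(n) for all n ≥ n₀. -/
open IsLocalRing

universe u v

section GradedFamily

variable {R : Type u} [Ring R]

/-- The ascending chain condition on families of submodules `N n ≤ M n` that are stable under
the given operators of degree one. -/
def GradedACC {M : ℕ → Type v} [∀ n, AddCommGroup (M n)] [∀ n, Module R (M n)] {ι : Type}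
    (x : ι → ∀ n, M n →ₗ[R] M (n + 1)) : Prop :=
  ∀ N : ℕ → ∀ n, Submodule R (M n), Monotone N →
    (∀ j i n, N j n ≤ (N j (n + 1)).comap (x i n)) → ∃ j₀, ∀ j, j₀ ≤ j → N j = N j₀

lemma GradedACC.of_injective {M M' : ℕ → Type v} [∀ n, AddCommGroup (M n)]
    [∀ n, Module R (M n)] [∀ n, AddCommGroup (M' n)] [∀ n, Module R (M' n)] {ι ι' : Type}
    {x : ι → ∀ n, M n →ₗ[R] M (n + 1)} {x' : ι' → ∀ n, M' n →ₗ[R] M' (n + 1)}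
    (h : GradedACC x) (Φ : (∀ n, Submodule R (M' n)) → ∀ n, Submodule R (M n))
    (hmono : Monotone Φ) (hinj : Function.Injective Φ)
    (hstable : ∀ N, (∀ i n, N n ≤ (N (n + 1)).comap (x' i n)) →
      ∀ i n, Φ N n ≤ (Φ N (n + 1)).comap (x i n)) :
    GradedACC x' := by
  intro N hN hs
  obtain ⟨j₀, hj⟩ := h (fun j => Φ (N j)) (hmono.comp hN) (fun j => hstable (N j) (hs j))
  exact ⟨j₀, fun j hjj => hinj (hj j hjj)⟩

lemma GradedACC.eventually_subsingleton {M : ℕ → Type v} [∀ n, AddCommGroup (M n)]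
    [∀ n, Module R (M n)] {ι : Type} [IsEmpty ι] {x : ι → ∀ n, M n →ₗ[R] M (n + 1)}
    (h : GradedACC x) : ∃ n₀, ∀ n, n₀ ≤ n → Subsingleton (M n) := by
  obtain ⟨j₀, hj⟩ := h (fun j n => if n < j then ⊤ else ⊥)
    (by
      intro a b hab n
      dsimp only
      split_ifs
      · exact le_rfl
      · omega
      · exact bot_le
      · exact le_rfl)
    (fun j i => isEmptyElim i)
  refine ⟨j₀, fun n hn => ?_⟩
  have := congrFun (hj (n + 1) (by omega)) n
  simp only [Nat.lt_succ_self, if_true, Nat.not_lt.mpr hn, if_false] at this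
  exact (Submodule.subsingleton_iff R).mp (subsingleton_of_bot_eq_top this.symm)

section Step

variable {M : ℕ → Type v} [∀ n, AddCommGroup (M n)] [∀ n, Module R (M n)] {r : ℕ}
  (x : Fin (r + 1) → ∀ n, M n →ₗ[R] M (n + 1))
  (hx : ∀ i j n m, x i (n + 1) (x j n m) = x j (n + 1) (x i n m))

/-- The operators induced by `x 1, …, x r` on the kernels of `x 0`. -/
def kerOperator (i : Fin r) (n : ℕ) :
    LinearMap.ker (x 0 n) →ₗ[R] LinearMap.ker (x 0 (n + 1)) :=
  (x i.succ n).restrict fun m hm => by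
    rw [LinearMap.mem_ker] at hm ⊢
    rw [hx, hm, map_zero]

/-- The operators induced by `x 1, …, x r` on the cokernels of `x 0`. -/
def cokerOperator (i : Fin r) (n : ℕ) :
    (M (n + 1) ⧸ LinearMap.range (x 0 n)) →ₗ[R]
      (M (n + 1 + 1) ⧸ LinearMap.range (x 0 (n + 1))) :=
  Submodule.mapQ _ _ (x i.succ (n + 1)) (by
    rintro _ ⟨m, rfl⟩
    exact ⟨x i.succ n m, hx _ _ _ _⟩)

variable {x}

lemma GradedACC.ker (h : GradedACC x) : GradedACC (kerOperator x hx) := by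
  refine h.of_injective (fun N n => (N n).map (LinearMap.ker (x 0 n)).subtype) ?_ ?_ ?_
  · exact fun N N' hN n => Submodule.map_mono (hN n)
  · intro N N' hN
    funext n
    exact Submodule.map_injective_of_injective (Submodule.subtype_injective _) (congrFun hN n)
  · rintro N hN i n _ ⟨m, hm, rfl⟩
    refine Fin.cases ?_ (fun i => ?_) i
    · have : x 0 n m = 0 := m.2
      simp [this]
    · exact ⟨_, hN i n hm, rfl⟩

lemma GradedACC.coker (h : GradedACC x) : GradedACC (cokerOperator x hx) := by
  refine h.of_injective (fun N n => match n with
    | 0 => ⊥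
    | n + 1 => (N n).comap (LinearMap.range (x 0 n)).mkQ) ?_ ?_ ?_
  · rintro N N' hN (_ | n)
    · exact le_rfl
    · exact Submodule.comap_mono (hN n)
  · intro N N' hN
    funext n
    exact Submodule.comap_injective_of_surjective (Submodule.mkQ_surjective _)
      (congrFun hN (n + 1))
  · rintro N hN i (_ | n)
    · exact bot_le
    · intro m hm
      refine Fin.cases ?_ (fun i => ?_) i
      · have : (LinearMap.range (x 0 (n + 1))).mkQ (x 0 (n + 1) m) = 0 := by simp
        simp only [Submodule.mem_comap, this, zero_mem]
      · exact hN i n hm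

end Step

end GradedFamily

lemma Polynomial.exists_eval_add_one_sub_eval (q : Polynomial ℚ) :
    ∃ p : Polynomial ℚ, ∀ t : ℚ, p.eval (t + 1) - p.eval t = q.eval t := by
  induction q using Polynomial.induction_on' with
  | add q₁ q₂ h₁ h₂ =>
    obtain ⟨p₁, h₁⟩ := h₁
    obtain ⟨p₂, h₂⟩ := h₂
    refine ⟨p₁ + p₂, fun t => ?_⟩
    rw [eval_add, eval_add, eval_add, ← h₁, ← h₂]
    ring
  | monomial n a =>
    refine ⟨C (a / (n + 1)) * Polynomial.bernoulli (n + 1), fun t => ?_⟩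
    have hn : (n + 1 : ℚ) ≠ 0 := by positivity
    rw [eval_mul, eval_mul, add_comm t, Polynomial.bernoulli_eval_one_add, eval_C, eval_C,
      eval_monomial, Nat.add_sub_cancel]
    push_cast
    field_simp
    ring

lemma exists_polynomial_of_eventually_sub_eq {f : ℕ → ℚ} {q : Polynomial ℚ} {n₀ : ℕ}
    (h : ∀ n, n₀ ≤ n → f (n + 1) - f n = q.eval (n : ℚ)) :
    ∃ p : Polynomial ℚ, ∀ n, n₀ ≤ n → f n = p.eval (n : ℚ) := by
  obtain ⟨p, hp⟩ := q.exists_eval_add_one_sub_eval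
  refine ⟨p + Polynomial.C (f n₀ - p.eval (n₀ : ℚ)), fun n hn => ?_⟩
  rw [Polynomial.eval_add, Polynomial.eval_C]
  induction n, hn using Nat.le_induction with
  | base => ring
  | succ n hn ih =>
    have h₁ := h n hn
    have h₂ := hp n
    push_cast
    linarith

lemma Module.toNat_length_ker_add {R : Type u} [Ring R] {M N : Type v} [AddCommGroup M]
    [Module R M] [AddCommGroup N] [Module R N] (f : M →ₗ[R] N) (hM : IsFiniteLength R M)
    (hN : IsFiniteLength R N) :
    (Module.length R (LinearMap.ker f)).toNat + (Module.length R N).toNat =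
      (Module.length R M).toNat + (Module.length R (N ⧸ LinearMap.range f)).toNat := by
  have h₁ := Module.length_eq_add_of_exact (LinearMap.ker f).subtype f.rangeRestrict
    (Submodule.subtype_injective _) f.surjective_rangeRestrict
    (LinearMap.exact_iff.mpr (by simp))
  have h₂ := Module.length_eq_add_of_exact (LinearMap.range f).subtype (LinearMap.range f).mkQ
    (Submodule.subtype_injective _) (Submodule.mkQ_surjective _)
    (LinearMap.exact_subtype_mkQ _)
  rw [← Module.length_ne_top_iff] at hM hN
  rw [h₁] at hM ⊢
  rw [h₂] at hN ⊢
  rw [ne_eq, ENat.add_eq_top, not_or] at hM hN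
  rw [ENat.toNat_add hM.1 hM.2, ENat.toNat_add hN.1 hN.2]
  ring

/-- **Hilbert–Serre** for a Noetherian graded family of finite length modules with finitely many
commuting operators of degree one. -/
theorem GradedACC.exists_hilbert_polynomial {R : Type u} [Ring R] {r : ℕ} {M : ℕ → Type v}
    [∀ n, AddCommGroup (M n)] [∀ n, Module R (M n)] (x : Fin r → ∀ n, M n →ₗ[R] M (n + 1))
    (hx : ∀ i j n m, x i (n + 1) (x j n m) = x j (n + 1) (x i n m)) (h : GradedACC x)
    (hM : ∀ n, IsFiniteLength R (M n)) :
    ∃ (p : Polynomial ℚ) (n₀ : ℕ), ∀ n, n₀ ≤ n →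
      ((Module.length R (M n)).toNat : ℚ) = p.eval (n : ℚ) := by
  induction r generalizing M with
  | zero =>
    obtain ⟨n₀, hn⟩ := h.eventually_subsingleton
    refine ⟨0, n₀, fun n hnn => ?_⟩
    have := hn n hnn
    simp [Module.length_eq_zero]
  | succ r ih =>
    obtain ⟨p, a, hp⟩ := ih (kerOperator x hx) (fun i j n m => Subtype.ext (hx _ _ _ _))
      (h.ker hx) (fun n => (hM n).of_injective (Submodule.subtype_injective _))
    obtain ⟨q, b, hq⟩ := ih (cokerOperator x hx)
      (fun i j n m => by
        obtain ⟨m, rfl⟩ := Submodule.mkQ_surjective _ m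
        exact congrArg (Submodule.mkQ _) (hx _ _ _ _))
      (h.coker hx) (fun n => (hM (n + 1)).of_surjective (Submodule.mkQ_surjective _))
    obtain ⟨s, hs⟩ := exists_polynomial_of_eventually_sub_eq (q := q - p) (n₀ := max a b)
      (f := fun n => ((Module.length R (M n)).toNat : ℚ)) (fun n hn => by
        have := congrArg (Nat.cast (R := ℚ))
          (Module.toNat_length_ker_add (x 0 n) (hM n) (hM (n + 1)))
        push_cast at this
        rw [hp n (le_of_max_le_left hn), hq n (le_of_max_le_right hn)] at this
        rw [Polynomial.eval_sub]
        linarith)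
    exact ⟨s, max a b, hs⟩

section Rees

variable {R : Type u} [CommRing R] {I : Ideal R} {B : Type v} [AddCommGroup B] [Module R B]

/-- The submodule of `B[X]` over the Rees algebra given by a family `N` with
`I • N i ≤ N (i + 1)`. -/
noncomputable def reesSubmodule (N : ℕ → Submodule R B) (hN : ∀ i, I • N i ≤ N (i + 1)) :
    Submodule (reesAlgebra I) (PolynomialModule R B) where
  carrier := { f | ∀ i, f.coeff i ∈ N i }
  add_mem' hf hg i := Submodule.add_mem _ (hf i) (hg i)
  zero_mem' _ := Submodule.zero_mem _
  smul_mem' s f hf i := by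
    have key (j k : ℕ) : I ^ j • N k ≤ N (j + k) := by
      induction j with
      | zero => simp
      | succ j ih =>
        rw [pow_succ', mul_smul, add_right_comm]
        exact (smul_mono_right _ ih).trans (hN _)
    rw [Subalgebra.smul_def, PolynomialModule.smul_apply]
    apply Submodule.sum_mem
    rintro ⟨j, k⟩ e
    rw [Finset.HasAntidiagonal.mem_antidiagonal] at e
    subst e
    exact key j k (Submodule.smul_mem_smul (s.2 j) (hf k))

lemma single_mem_reesSubmodule {N : ℕ → Submodule R B} (hN : ∀ i, I • N i ≤ N (i + 1))
    {n : ℕ} {b : B} : PolynomialModule.single R n b ∈ reesSubmodule N hN ↔ b ∈ N n := by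
  refine ⟨fun h => by simpa using h n, fun h i => ?_⟩
  rw [PolynomialModule.coeff_single, Finsupp.single_apply]
  split_ifs with e
  · exact e ▸ h
  · exact zero_mem _

/-- An ascending chain of `I`-stable families contained in a stable filtration stabilizes. -/
lemma Ideal.Filtration.Stable.chain_stabilizes [IsNoetherianRing R] [Module.Finite R B]
    {F : I.Filtration B} (hF : F.Stable) (N : ℕ → ℕ → Submodule R B) (hmono : Monotone N)
    (hN : ∀ j i, I • N j i ≤ N j (i + 1)) (hle : ∀ j i, N j i ≤ F.N i) :
    ∃ j₀, ∀ j, j₀ ≤ j → N j = N j₀ := by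
  rw [← F.submodule_fg_iff_stable fun i => IsNoetherian.noetherian _] at hF
  have := isNoetherian_of_fg_of_noetherian _ hF
  obtain ⟨j₀, hj⟩ := monotone_stabilizes_iff_noetherian.mpr this
    ⟨fun j => (reesSubmodule (N j) (hN j)).comap F.submodule.subtype,
      fun a b hab f hf i => hmono hab i (hf i)⟩
  have hmem (n : ℕ) (b : B) (hb : b ∈ F.N n) : PolynomialModule.single R n b ∈ F.submodule :=
    (single_mem_reesSubmodule F.smul_le).mpr hb
  refine ⟨j₀, fun j hjj => le_antisymm (fun n b hb => ?_) (hmono hjj)⟩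
  have h₁ : (⟨_, hmem n b (hle j n hb)⟩ : F.submodule) ∈
      (reesSubmodule (N j) (hN j)).comap F.submodule.subtype :=
    (single_mem_reesSubmodule (hN j)).mpr hb
  have h₂ : (reesSubmodule (N j₀) (hN j₀)).comap F.submodule.subtype =
      (reesSubmodule (N j) (hN j)).comap F.submodule.subtype := hj j hjj
  rw [← h₂] at h₁
  exact (single_mem_reesSubmodule (hN j₀)).mp h₁

variable (F : I.Filtration B) (G : ℕ → Submodule R B)

/-- Multiplication by an element of `I` on the quotients `F n / (F n ⊓ G n)`. -/
def mulOperator (hG : ∀ n, I • G n ≤ G (n + 1)) (a : I) (n : ℕ) :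
    (F.N n ⧸ (F.N n ⊓ G n).comap (F.N n).subtype) →ₗ[R]
      (F.N (n + 1) ⧸ (F.N (n + 1) ⊓ G (n + 1)).comap (F.N (n + 1)).subtype) :=
  Submodule.mapQ _ _
    ((LinearMap.lsmul R B a).restrict fun _ hb => F.smul_le n (Submodule.smul_mem_smul a.2 hb))
    fun _ hb => ⟨F.smul_le n (Submodule.smul_mem_smul a.2 hb.1),
      hG n (Submodule.smul_mem_smul a.2 hb.2)⟩

variable {F G}

lemma Ideal.Filtration.Stable.gradedACC [IsNoetherianRing R] [Module.Finite R B]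
    (hF : F.Stable) (hG : ∀ n, I • G n ≤ G (n + 1)) {ι : Type} (a : ι → I)
    (ha : Ideal.span (Set.range fun i => (a i : R)) = I) :
    GradedACC fun i => mulOperator F G hG (a i) := by
  intro N hmono hs
  obtain ⟨j₀, hj⟩ := hF.chain_stabilizes
    (fun j n => ((N j n).comap (Submodule.mkQ _)).map (F.N n).subtype)
    (fun a b hab n => Submodule.map_mono (Submodule.comap_mono (hmono hab n)))
    (fun j n => by
      refine (Submodule.smul_mono_left ha.ge).trans ?_
      refine Submodule.smul_le.mpr fun c hc b hb => ?_
      induction hc using Submodule.span_induction with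
      | zero => simp
      | add c₁ c₂ _ _ h₁ h₂ => exact add_smul c₁ c₂ b ▸ add_mem h₁ h₂
      | smul t c _ h => exact smul_assoc t c b ▸ Submodule.smul_mem _ t h
      | mem c hc =>
        obtain ⟨i, rfl⟩ := hc
        obtain ⟨y, hy, rfl⟩ := hb
        exact ⟨_, hs j i n hy, rfl⟩)
    (fun j n => Submodule.map_subtype_le _ _)
  refine ⟨j₀, fun j hjj => funext fun n => ?_⟩
  exact Submodule.comap_injective_of_surjective (Submodule.mkQ_surjective _)
    (Submodule.map_injective_of_injective (Submodule.subtype_injective _)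
      (congrFun (hj j hjj) n))

end Rees

theorem stmt14 (R : Type) [CommRing R] [IsNoetherianRing R] [IsLocalRing R]
    (I : Ideal R)
    (B : Type) [AddCommGroup B] [Module R B] [Module.Finite R B]
    (A : Submodule R B) (k : ℕ)
    (hfin : ∃ n₁ : ℕ, ∀ n, n₁ ≤ n →
      IsFiniteLength R
        (↥(I ^ (n - k) • A) ⧸
          Submodule.comap (I ^ (n - k) • A).subtype
            (I ^ (n - k) • A ⊓ I ^ n • (⊤ : Submodule R B)))) :
    ∃ (p : Polynomial ℚ) (n₀ : ℕ), ∀ n, n₀ ≤ n →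
      ∃ c : ℕ,
        modLength R
          (↥(I ^ (n - k) • A) ⧸
            Submodule.comap (I ^ (n - k) • A).subtype
              (I ^ (n - k) • A ⊓ I ^ n • (⊤ : Submodule R B))) = (c : ℕ∞) ∧
        (c : ℚ) = Polynomial.eval (n : ℚ) p := by
  obtain ⟨n₁, hfin⟩ := hfin
  let d := max n₁ k
  have hd (n : ℕ) : n + 1 + d - k = (n + d - k) + 1 := by
    have := le_max_right n₁ k
    omega
  let F : I.Filtration B :=
    { N := fun n => I ^ (n + d - k) • A
      mono := fun n => by
        rw [hd]
        exact Submodule.smul_mono_left (Ideal.pow_le_pow_right (Nat.le_succ _))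
      smul_le := fun n => by rw [hd, pow_succ', mul_smul] }
  have hF : F.Stable := ⟨0, fun n _ => by
    change I • I ^ (n + d - k) • A = I ^ (n + 1 + d - k) • A
    rw [hd, pow_succ', mul_smul]⟩
  let G (n : ℕ) : Submodule R B := I ^ (n + d) • ⊤
  have hG (n : ℕ) : I • G n ≤ G (n + 1) := by
    change I • I ^ (n + d) • ⊤ ≤ I ^ (n + 1 + d) • ⊤
    rw [add_right_comm, pow_succ', mul_smul]
  obtain ⟨r, a, ha⟩ := Submodule.fg_iff_exists_fin_generating_family.mp
    (IsNoetherian.noetherian I)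
  have hmem (i : Fin r) : a i ∈ I := ha ▸ Submodule.subset_span ⟨i, rfl⟩
  obtain ⟨p, n₀, hp⟩ := (hF.gradedACC hG (fun i => ⟨a i, hmem i⟩) ha).exists_hilbert_polynomial _
    (fun i j n m => by
      obtain ⟨m, rfl⟩ := Submodule.mkQ_surjective _ m
      exact congrArg (Submodule.mkQ _) (Subtype.ext (smul_comm (a i) (a j) (m : B))))
    (fun n => hfin (n + d) (le_trans (le_max_left _ _) (Nat.le_add_left _ _)))
  refine ⟨p.comp (Polynomial.X - Polynomial.C (d : ℚ)), n₀ + d, fun n hn => ?_⟩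
  obtain ⟨m, rfl⟩ := Nat.exists_eq_add_of_le' (le_trans (Nat.le_add_left d n₀) hn)
  have hlen := Module.length_ne_top_iff.mpr
    (hfin (m + d) (le_trans (le_max_left _ _) (Nat.le_add_left _ _)))
  refine ⟨_, ?_, (hp m (by omega)).trans (by simp)⟩
  rw [modLength, ← Module.coe_length]
  exact congrArg _ (ENat.natCast_toNat hlen).symm
end

section
/- Let (R,P) be a commutative Noetherian local ring, and let x₁,…,x_t (t ≥ 1) be a regular sequence in R generating the ideal q = (x₁,…,x_t). For integers s ≥ r ≥ 1, Tor_1^R(R/q^s, R/q^r) is isomorphic to q^s/q^{s+r}, and this module has finite length if and only if R/q has finite length. -/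
open CategoryTheory IsLocalRing

/-- `Tor_i^R(M, N)` as an object of `ModuleCat R`. -/
noncomputable def TorM (R : Type) [CommRing R] (i : ℕ)
    (M : Type) [AddCommGroup M] [Module R M]
    (N : Type) [AddCommGroup N] [Module R N] : ModuleCat R :=
  ((Tor (ModuleCat R) i).obj (ModuleCat.of R M)).obj (ModuleCat.of R N)

namespace CategoryTheory.ProjectiveResolution

open Limits

universe v u

variable {C : Type u} [Category.{v} C] [Abelian C] {S : ShortComplex C}

/-- The complex `⋯ ⟶ Q₁ ⟶ Q₀ ⟶ S.X₂` obtained by splicing a projective resolution `Q` of `S.X₁`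
with the map `S.f`. -/
noncomputable def augmentComplex (S : ShortComplex C) (Q : ProjectiveResolution S.X₁) :
    ChainComplex C ℕ :=
  Q.complex.augment (Q.π.f 0 ≫ S.f : Q.complex.X 0 ⟶ S.X₂) (by
    exact (Category.assoc _ _ _).symm.trans ((Q.complex_d_comp_π_f_zero =≫ S.f).trans zero_comp))

lemma augmentComplex_exactAt_succ (Q : ProjectiveResolution S.X₁) (hS : S.ShortExact) (n : ℕ) :
    (augmentComplex S Q).ExactAt (n + 1) := by
  rw [HomologicalComplex.exactAt_iff' _ (n + 1 + 1) (n + 1) n (by simp) (by simp)]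
  match n with
  | 0 =>
    let α : ShortComplex.mk (Q.complex.d 1 0) (Q.π.f 0) Q.complex_d_comp_π_f_zero ⟶
        (augmentComplex S Q).sc' 2 1 0 :=
      { τ₁ := 𝟙 (Q.complex.X 1), τ₂ := 𝟙 (Q.complex.X 0), τ₃ := S.f
        comm₁₂ := (Category.id_comp _).trans (Category.comp_id _).symm
        comm₂₃ := Category.id_comp _ }
    have : Epi α.τ₁ := inferInstanceAs (Epi (𝟙 (Q.complex.X 1)))
    have : IsIso α.τ₂ := inferInstanceAs (IsIso (𝟙 (Q.complex.X 0)))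
    have : Mono α.τ₃ := hS.mono_f
    exact (ShortComplex.exact_iff_of_epi_of_isIso_of_mono α).mp Q.exact₀
  | n + 1 => exact Q.exact_succ n

lemma augmentComplex_d_comp (Q : ProjectiveResolution S.X₁) :
    (augmentComplex S Q).d 1 0 ≫ S.g = 0 :=
  (Category.assoc _ _ _).trans ((Q.π.f 0 ≫= S.zero).trans comp_zero)

lemma augmentComplex_exact_zero (Q : ProjectiveResolution S.X₁) (hS : S.ShortExact) :
    (ShortComplex.mk _ _ (augmentComplex_d_comp Q)).Exact := by
  let α : ShortComplex.mk _ _ (augmentComplex_d_comp Q) ⟶ S :=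
    { τ₁ := Q.π.f 0, τ₂ := 𝟙 S.X₂, τ₃ := 𝟙 S.X₃
      comm₁₂ := (Category.comp_id _).symm
      comm₂₃ := (Category.id_comp _).trans (Category.comp_id _).symm }
  have : Epi α.τ₁ := inferInstanceAs (Epi (Q.π.f 0))
  have : IsIso α.τ₂ := inferInstanceAs (IsIso (𝟙 S.X₂))
  have : Mono α.τ₃ := inferInstanceAs (Mono (𝟙 S.X₃))
  exact (ShortComplex.exact_iff_of_epi_of_isIso_of_mono α).mpr hS.exact

instance [Projective S.X₂] (Q : ProjectiveResolution S.X₁) (n : ℕ) :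
    Projective ((augmentComplex S Q).X n) :=
  match n with
  | 0 => ‹_›
  | n + 1 => Q.projective n

/-- Splicing a short exact sequence with projective middle term and a projective resolution of its
first term gives a projective resolution of its last term. -/
noncomputable def ofShortExact (hS : S.ShortExact) [Projective S.X₂]
    (Q : ProjectiveResolution S.X₁) : ProjectiveResolution S.X₃ where
  complex := augmentComplex S Q
  π := (ChainComplex.toSingle₀Equiv _ _).symm ⟨S.g, augmentComplex_d_comp Q⟩
  quasiIso := ⟨fun n => by
    cases n
    · rw [ChainComplex.quasiIsoAt₀_iff, ShortComplex.quasiIso_iff_of_zeros' _ rfl rfl rfl]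
      refine (ShortComplex.exact_and_epi_g_iff_of_iso ?_).2
        ⟨augmentComplex_exact_zero Q hS, hS.epi_g⟩
      refine ShortComplex.isoMk (Iso.refl _) (Iso.refl _) (Iso.refl _)
        ((Category.id_comp _).trans (Category.comp_id _).symm)
        ((Category.id_comp _).trans (Eq.trans ?_ (Category.comp_id _).symm))
      exact (ChainComplex.toSingle₀Equiv_symm_apply_f_zero (C := augmentComplex S Q) S.g
        (augmentComplex_d_comp Q)).symm
    · rw [quasiIsoAt_iff_exactAt']
      · exact augmentComplex_exactAt_succ Q hS _
      · apply ChainComplex.exactAt_succ_single_obj⟩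

end CategoryTheory.ProjectiveResolution

section Tensor

open TensorProduct LinearMap

universe v

variable {R : Type*} [CommRing R]

/-- If `g` presents `K` as the cokernel of `S.f`, the homology of `S` is the kernel of the map
`h : K → S.X₃` through which `S.g` factors. -/
noncomputable def homologyEquivKer (S : ShortComplex (ModuleCat.{v} R))
    {K : Type v} [AddCommGroup K] [Module R K] (g : S.X₂ →ₗ[R] K) (h : K →ₗ[R] S.X₃)
    (hfg : Function.Exact S.f.hom g) (hg : Function.Surjective g) (hS : S.g.hom = h ∘ₗ g) :
    S.homology ≃ₗ[R] ker h :=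
  let φ : ker S.g.hom →ₗ[R] ker h := g.restrict fun x hx => by rwa [hS] at hx
  S.moduleCatHomologyIso.toLinearEquiv.trans <|
  (Submodule.quotEquivOfEq _ _ (by
    ext x
    rw [mem_ker, ← Submodule.coe_eq_zero, show (φ x : K) = g x.1 from rfl, hfg x.1]
    exact ⟨fun ⟨a, ha⟩ => ⟨a, congrArg Subtype.val ha⟩, fun ⟨a, ha⟩ => ⟨a, Subtype.ext ha⟩⟩)).trans
  (φ.quotKerEquivOfSurjective fun y => by
    obtain ⟨x, hx⟩ := hg y
    exact ⟨⟨x, by simp [hS, hx]⟩, Subtype.ext hx⟩)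

theorem quotient_one_tmul_eq_zero_iff (I J : Ideal R) (x : J) :
    (1 : R ⧸ I) ⊗ₜ[R] x = 0 ↔ (x : R) ∈ I * J := by
  rw [← (quotTensorEquivQuotSMul J I).map_eq_zero_iff, quotTensorEquivQuotSMul_mk_one_tmul,
    Submodule.Quotient.mk_eq_zero, Submodule.mem_smul_top_iff, smul_eq_mul]

theorem lTensor_subtype_one_tmul_eq_zero_iff (I J : Ideal R) (x : J) :
    J.subtype.lTensor (R ⧸ I) (1 ⊗ₜ[R] x) = 0 ↔ (x : R) ∈ I := by
  rw [← (TensorProduct.rid R (R ⧸ I)).map_eq_zero_iff]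
  simp [Algebra.smul_def, Ideal.Quotient.eq_zero_iff_mem]

/-- If `f` and `g` are exact at `B`, then `A ⧸ ker f` is isomorphic to `ker g`. -/
noncomputable def quotientEquivKerOfExact {A B C : Type*} [AddCommGroup A] [Module R A]
    [AddCommGroup B] [Module R B] [AddCommGroup C] [Module R C]
    (f : A →ₗ[R] B) (g : B →ₗ[R] C) (hfg : Function.Exact f g) (S : Submodule R A)
    (hS : S = ker f) : (A ⧸ S) ≃ₗ[R] ker g :=
  (Submodule.quotEquivOfEq _ _ hS).trans
    (f.quotKerEquivRange.trans (LinearEquiv.ofEq _ _ hfg.linearMap_ker_eq.symm))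

/-- For ideals `I ≤ J`, the kernel of `(R ⧸ I) ⊗ J → (R ⧸ I) ⊗ R` is `I ⧸ I * J`. -/
noncomputable def quotientMulEquivKerLTensor {I J : Ideal R} (h : I ≤ J) :
    (I ⧸ Submodule.comap I.subtype (I * J)) ≃ₗ[R] ker (J.subtype.lTensor (R ⧸ I)) :=
  quotientEquivKerOfExact (TensorProduct.mk R (R ⧸ I) J 1 ∘ₗ Submodule.inclusion h) _ (fun y => by
    obtain ⟨z, rfl⟩ := (quotTensorEquivQuotSMul J I).symm.surjective y
    obtain ⟨z, rfl⟩ := Submodule.Quotient.mk_surjective _ z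
    rw [quotTensorEquivQuotSMul_symm_mk]
    refine (lTensor_subtype_one_tmul_eq_zero_iff I J z).trans ⟨fun hz => ⟨⟨z, hz⟩, rfl⟩, ?_⟩
    rintro ⟨x, hx⟩
    rw [← lTensor_subtype_one_tmul_eq_zero_iff I J z, ← hx]
    exact (lTensor_subtype_one_tmul_eq_zero_iff I J (Submodule.inclusion h x)).mpr x.2) _ (by
    ext x
    exact (quotient_one_tmul_eq_zero_iff I J (Submodule.inclusion h x)).symm)

end Tensor

section Tor

open MonoidalCategory TensorProduct LinearMap

/-- `Tor₁(M, R ⧸ J)` is the kernel of `M ⊗ J → M ⊗ R`. -/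
theorem nonempty_torM_one_equiv_ker (R : Type) [CommRing R] (M : Type) [AddCommGroup M]
    [Module R M] (J : Ideal R) :
    Nonempty (TorM R 1 M (R ⧸ J) ≃ₗ[R] ker (J.subtype.lTensor M)) := by
  let S : ShortComplex (ModuleCat R) :=
    ShortComplex.mk (ModuleCat.ofHom J.subtype) (ModuleCat.ofHom J.mkQ) (by
      ext x; exact (Submodule.Quotient.mk_eq_zero J).mpr x.2)
  have hS : S.ShortExact :=
    { exact := (ShortComplex.ShortExact.moduleCat_exact_iff_function_exact S).mpr
        (LinearMap.exact_subtype_mkQ J)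
      mono_f := (ModuleCat.mono_iff_injective _).mpr J.subtype_injective
      epi_g := (ModuleCat.epi_iff_surjective _).mpr J.mkQ_surjective }
  have : Projective S.X₂ := inferInstanceAs (Projective (ModuleCat.of R R))
  let Q := ProjectiveResolution.of S.X₁
  let P := ProjectiveResolution.ofShortExact hS Q
  let F := (tensoringLeft (ModuleCat R)).obj (ModuleCat.of R M)
  let f := (Q.complex.d 1 0).hom
  let g : Q.complex.X 0 →ₗ[R] J := (Q.π.f 0).hom
  have hg : Function.Surjective g := (ModuleCat.epi_iff_surjective _).mp
    (inferInstanceAs (Epi (Q.π.f 0)))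
  have hfg : Function.Exact f g :=
    (ShortComplex.ShortExact.moduleCat_exact_iff_function_exact _).mp Q.exact₀
  let K := (F.mapHomologicalComplex _).obj P.complex
  let e : TorM R 1 M (R ⧸ J) ≅ (K.sc' 2 1 0).homology :=
    P.isoLeftDerivedObj F 1 ≪≫ ShortComplex.homologyMapIso (K.isoSc' 2 1 0 (by simp) (by simp))
  exact ⟨e.toLinearEquiv.trans (homologyEquivKer (K.sc' 2 1 0) (g.lTensor M) (J.subtype.lTensor M)
    (lTensor_exact M hfg hg) (lTensor_surjective M hg) (lTensor_comp M J.subtype g))⟩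

end Tor

section FiniteLength

open Polynomial

variable {R : Type*} [CommRing R] [IsNoetherianRing R]

theorem isFiniteLength_quotient_iff [IsLocalRing R] (I : Ideal R) :
    IsFiniteLength R (R ⧸ I) ↔ ∃ n, maximalIdeal R ^ n ≤ I := by
  rw [isFiniteLength_iff_isNoetherian_isArtinian,
    and_iff_right (inferInstance : IsNoetherian R (R ⧸ I))]
  let e : R ⧸ I →ₛₗ[Ideal.Quotient.mk I] R ⧸ I := ⟨.id _, fun _ _ ↦ rfl⟩
  rw [e.isArtinian_iff_of_bijective Function.bijective_id]
  refine ⟨fun h => ?_, fun ⟨n, hn⟩ => ?_⟩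
  · have : IsArtinianRing (R ⧸ I) := h
    exact exists_maximalIdeal_pow_le_of_isArtinianRing_quotient I
  · rcases subsingleton_or_nontrivial (R ⧸ I) with _ | _
    · infer_instance
    have := IsLocalRing.of_surjective' (Ideal.Quotient.mk I) Ideal.Quotient.mk_surjective
    have := IsLocalHom.of_surjective (Ideal.Quotient.mk I) Ideal.Quotient.mk_surjective
    have hmap : (maximalIdeal R).map (Ideal.Quotient.mk I) = maximalIdeal (R ⧸ I) := by
      ext x
      obtain ⟨x, rfl⟩ := Ideal.Quotient.mk_surjective x
      simp [sup_eq_left.mpr (le_maximalIdeal (Ideal.Quotient.nontrivial_iff.mp ‹_›))]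
    refine (isArtinianRing_iff_isNilpotent_maximalIdeal (R ⧸ I)).mpr ⟨n, ?_⟩
    rw [← hmap, ← Ideal.map_pow, Ideal.zero_eq_bot,
      Ideal.map_eq_bot_iff_le_ker, Ideal.mk_ker]
    exact hn

theorem exists_pow_smul_eq_zero_of_isArtinian [IsLocalRing R] (N : Type*) [AddCommGroup N]
    [Module R N] [Module.Finite R N] [IsArtinian R N] {a : R} (ha : a ∈ maximalIdeal R) :
    ∃ n, ∀ x : N, a ^ n • x = 0 := by
  obtain ⟨n, hn⟩ := IsArtinian.range_smul_pow_stabilizes N a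
  have h1 := hn (n + 1) (Nat.le_succ n)
  have : LinearMap.range (a ^ n • LinearMap.id : N →ₗ[R] N) = ⊥ := by
    refine Submodule.eq_bot_of_le_smul_of_le_jacobson_bot (maximalIdeal R) _
      (IsNoetherian.noetherian _) ?_ (maximalIdeal_le_jacobson _)
    conv_lhs => rw [h1]
    rintro _ ⟨x, rfl⟩
    rw [LinearMap.smul_apply, pow_succ', mul_smul]
    exact Submodule.smul_mem_smul ha ⟨x, rfl⟩
  refine ⟨n, fun x => ?_⟩
  have := this.le ⟨x, rfl⟩
  simpa using this

/-- A determinant-trick cancellation: if `a I ⊆ q I` and `I` contains a nonzerodivisor, then some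
power of `a` lies in `q`. -/
theorem mem_radical_of_mul_mem_mul {I q : Ideal R} {x a : R} (hx : x ∈ nonZeroDivisors R)
    (hxI : x ∈ I) (h : ∀ y ∈ I, a * y ∈ q * I) : a ∈ q.radical := by
  obtain ⟨p, hp, -, hc, h0⟩ :=
    LinearMap.exists_monic_and_natDegree_eq_and_coeff_mem_pow_and_aeval_eq_zero R
      (algebraMap R (Module.End R I) a) q (by
      rintro _ ⟨y, rfl⟩
      exact (Submodule.mem_smul_top_iff q I _).mpr (h y y.2))
  rw [aeval_algebraMap_apply] at h0
  have h1 : p.eval a * x = 0 := by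
    have := congrArg Subtype.val (LinearMap.congr_fun h0 ⟨x, hxI⟩)
    simpa using this
  have h2 : p.eval a = 0 := (mem_nonZeroDivisors_iff_right.mp hx) _ h1
  rw [eval_eq_sum_range, Finset.sum_range_succ, hp.coeff_natDegree, one_mul] at h2
  refine ⟨p.natDegree, ?_⟩
  rw [eq_neg_of_add_eq_zero_right h2]
  refine q.neg_mem (q.sum_mem fun i hi => q.mul_mem_right _ ?_)
  exact Ideal.pow_le_self (Nat.sub_ne_zero_of_lt (Finset.mem_range.mp hi)) (hc i)

end FiniteLength

theorem stmt18 (R : Type) [CommRing R] [IsNoetherianRing R] [IsLocalRing R]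
    (xs : List R) (hlen : 1 ≤ xs.length)
    (hreg : RingTheory.Sequence.IsRegular R xs)
    (q : Ideal R) (hq : q = Ideal.span {a : R | a ∈ xs})
    (s r : ℕ) (hsr : r ≤ s) (hr : 1 ≤ r) :
    Nonempty
      (↥(TorM R 1 (R ⧸ q ^ s) (R ⧸ q ^ r)) ≃ₗ[R]
        (↥(q ^ s) ⧸ Submodule.comap (q ^ s).subtype (q ^ (s + r)))) ∧
    (IsFiniteLength R ↥(TorM R 1 (R ⧸ q ^ s) (R ⧸ q ^ r)) ↔
      IsFiniteLength R (R ⧸ q)) := by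
  have hTor : Nonempty (TorM R 1 (R ⧸ q ^ s) (R ⧸ q ^ r) ≃ₗ[R]
      (↥(q ^ s) ⧸ Submodule.comap (q ^ s).subtype (q ^ (s + r)))) := by
    rw [pow_add]
    obtain ⟨e₁⟩ := nonempty_torM_one_equiv_ker R (R ⧸ q ^ s) (q ^ r)
    exact ⟨e₁.trans (quotientMulEquivKerLTensor (Ideal.pow_le_pow_right hsr)).symm⟩
  refine ⟨hTor, ?_⟩
  obtain ⟨e⟩ := hTor
  constructor
  · intro h
    have h' := h.of_surjective (f := e.toLinearMap) e.surjective
    obtain ⟨_, _⟩ := isFiniteLength_iff_isNoetherian_isArtinian.mp h'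
    obtain ⟨x, l, rfl⟩ := List.exists_cons_of_length_pos hlen
    have hx : x ∈ nonZeroDivisors R := by
      have := ((RingTheory.Sequence.isRegular_cons_iff R x l).mp hreg).1
      exact mem_nonZeroDivisors_iff_right.mpr fun y hy =>
        this.right_eq_zero_of_smul (by simpa [mul_comm] using hy)
    have hxq : x ∈ q := hq ▸ Ideal.subset_span (by simp)
    refine (isFiniteLength_quotient_iff q).mpr
      (Ideal.exists_pow_le_of_le_radical_of_fg (fun a ha => ?_) (IsNoetherian.noetherian _))
    obtain ⟨n, hn⟩ := exists_pow_smul_eq_zero_of_isArtinian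
      (↥(q ^ s) ⧸ Submodule.comap (q ^ s).subtype (q ^ (s + r))) ha
    refine Ideal.mem_radical_of_pow_mem (m := n)
      (mem_radical_of_mul_mem_mul (pow_mem hx s) (Ideal.pow_mem_pow hxq s) fun y hy => ?_)
    have := (Submodule.Quotient.mk_eq_zero _).mp (hn (Submodule.Quotient.mk ⟨y, hy⟩))
    rw [← pow_succ']
    exact Ideal.pow_le_pow_right (by omega) this
  · rw [isFiniteLength_quotient_iff]
    rintro ⟨n, hn⟩
    have h : IsFiniteLength R (R ⧸ q ^ (s + r)) := (isFiniteLength_quotient_iff _).mpr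
      ⟨n * (s + r), by rw [pow_mul]; exact Ideal.pow_right_mono hn _⟩
    have h' := h.of_injective (f := (Submodule.comap (q ^ s).subtype (q ^ (s + r))).mapQ
      (q ^ (s + r)) (q ^ s).subtype le_rfl) (by
        rw [← LinearMap.ker_eq_bot, Submodule.ker_mapQ]; simp)
    exact h'.of_injective (f := e.toLinearMap) e.injective
end
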